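/- For every function μ : [2,∞) → (0,∞) with μ(t) → ∞ as t → ∞ there exists a continuous function ε : [2,∞) → ℝ with ε(t) → 0 as t → ∞ and |ε(t)| ≤ μ(t)/log t for all t ≥ 2, such that the set {ζ(1/2 + ε(t) + i·t) : t ∈ [2,∞)} is dense in ℂ. -/

import Mathlib

open Complex Filter Set Topology


lemma sum_aux (y : ℝ) (hy : 1 ≤ y) (n : ℕ) :
    ∑ j ∈ Finset.range (n+1), ((j:ℝ)+2)/((j:ℝ)^2+y^2) ≤
      (1/2) * Real.log (((n:ℝ)^2+y^2)/y^2) + ∑ j ∈ Finset.range (n+1), (5/2)*(1/((j:ℝ)^2+1)) := by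
  induction n with
  | zero =>
    have h1 : (2:ℝ)/y^2 ≤ 5/2 := by
      rw [div_le_iff₀ (by positivity)]; nlinarith
    have : y^2 ≠ 0 := by positivity
    simp [div_self this]
    exact h1
  | succ n ih =>
    rw [Finset.sum_range_succ, Finset.sum_range_succ _ (n+1)]
    set b : ℝ := ((n+1:ℕ):ℝ)^2+y^2 with hb
    set a : ℝ := (n:ℝ)^2+y^2 with ha
    have hapos : 0 < a := by positivity
    have hbpos : 0 < b := by positivity
    have hlog : Real.log (b/y^2) = Real.log (a/y^2) + Real.log (b/a) := by
      rw [← Real.log_mul (by positivity) (by positivity)]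
      congr 1; field_simp
    have h2 : 1 - (b/a)⁻¹ ≤ Real.log (b/a) := Real.one_sub_inv_le_log_of_pos (by positivity)
    have h3 : 1 - (b/a)⁻¹ = (2*((n:ℝ)+1) - 1)/b := by
      rw [inv_div, eq_div_iff hbpos.ne', sub_mul, div_mul_cancel₀ _ hbpos.ne', hb, ha]; push_cast; ring
    have h4 : 1/b ≤ 1/(((n+1:ℕ):ℝ)^2+1) := by
      apply one_div_le_one_div_of_le (by positivity); rw [hb]; nlinarith
    have h5 : (((n+1:ℕ):ℝ)+2)/b = (1/2)*((2*((n:ℝ)+1) - 1)/b) + (5/2)*(1/b) := by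
      push_cast; ring
    rw [h5, hlog]
    linarith

lemma sum_const : ∃ C : ℝ, 0 ≤ C ∧ ∀ n : ℕ, ∑ j ∈ Finset.range (n+1), (5/2)*(1/((j:ℝ)^2+1)) ≤ C := by
  have hs : Summable (fun j : ℕ => (5/2)*(1/((j:ℝ)^2+1))) := by
    apply Summable.mul_left
    rw [← summable_nat_add_iff 1]
    have := (summable_nat_add_iff 1).mpr (Real.summable_one_div_nat_pow (p := 2) |>.mpr (by norm_num))
    refine Summable.of_nonneg_of_le (fun _ => by positivity) (fun j => ?_) this
    apply one_div_le_one_div_of_le (by positivity); linarith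
  exact ⟨_, tsum_nonneg (fun _ => by positivity), fun n => hs.sum_le_tsum _ (fun _ _ => by positivity)⟩

lemma norm_ratio_aux (σ x y : ℝ) (hσ : 0 < σ) (hx : 0 ≤ x) (h4 : 2*σ+x ≤ 4) (hy : 1 ≤ y) (j : ℕ) :
    ‖(σ + x + y * I + j : ℂ)‖ * Real.exp (-(x * (((j:ℝ)+2)/((j:ℝ)^2+y^2)))) ≤ ‖(σ + y * I + j : ℂ)‖ := by
  have e1 : ‖(σ + x + y * I + j : ℂ)‖ = Real.sqrt ((σ+x+j)^2+y^2) := by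
    rw [← Complex.norm_add_mul_I]; congr 1; push_cast; ring
  have e2 : ‖(σ + y * I + j : ℂ)‖ = Real.sqrt ((σ+j)^2+y^2) := by
    rw [← Complex.norm_add_mul_I]; congr 1; push_cast; ring
  rw [e1, e2]
  apply Real.le_sqrt_of_sq_le
  rw [mul_pow, Real.sq_sqrt (by positivity), ← Real.exp_nat_mul]
  set q : ℝ := x*(2*j+4)/((j:ℝ)^2+y^2) with hq
  have : ((2:ℕ):ℝ) * (-(x * (((j:ℝ)+2)/((j:ℝ)^2+y^2)))) = -q := by rw [hq]; push_cast; ring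
  rw [this, Real.exp_neg, ← div_eq_mul_inv, div_le_iff₀ (Real.exp_pos _)]
  have h1 : 1 + q ≤ Real.exp q := by linarith [Real.add_one_le_exp q]
  have hpos : 0 < (σ+j)^2+y^2 := by positivity
  have hD : 0 < (j:ℝ)^2+y^2 := by positivity
  have h2 : (σ+x+j)^2+y^2 ≤ ((σ+j)^2+y^2)*(1+q) := by
    have hj : (0:ℝ) ≤ j := by positivity
    have : x*(2*j+4) ≤ ((σ+j)^2+y^2) * q := by
      rw [hq, ← mul_div_assoc, le_div_iff₀ hD, mul_comm]
      apply mul_le_mul_of_nonneg_right _ (by positivity)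
      nlinarith
    nlinarith
  exact h2.trans (by gcongr)

lemma gamma_ratio : ∃ C : ℝ, 0 ≤ C ∧ ∀ σ x y : ℝ, 0 < σ → 0 ≤ x → 2*σ+x ≤ 4 → 1 ≤ y →
    ‖Complex.Gamma (σ + y * I)‖ * (y^x * Real.exp (-(C*x))) ≤ ‖Complex.Gamma (σ + x + y * I)‖ := by
  obtain ⟨C, hC0, hC⟩ := sum_const
  refine ⟨C, hC0, fun σ x y hσ hx h4 hy => ?_⟩
  have key : ∀ n : ℕ, 1 ≤ n → ‖Complex.GammaSeq (σ + y*I) n‖ *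
      (((n:ℝ)^2/((n:ℝ)^2+y^2))^(x/2) * (y^x * Real.exp (-(C*x)))) ≤ ‖Complex.GammaSeq (σ+x+y*I) n‖ := by
    intro n hn
    have hn0 : (0:ℝ) < n := by exact_mod_cast hn
    have hprod : (∏ j ∈ Finset.range (n+1), ‖(σ + x + y * I + j : ℂ)‖) *
        Real.exp (-(x * ∑ j ∈ Finset.range (n+1), ((j:ℝ)+2)/((j:ℝ)^2+y^2))) ≤
        ∏ j ∈ Finset.range (n+1), ‖(σ + y * I + j : ℂ)‖ := by
      rw [Finset.mul_sum, ← Finset.sum_neg_distrib, Real.exp_sum, ← Finset.prod_mul_distrib]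
      exact Finset.prod_le_prod (fun _ _ => by positivity)
        (fun j _ => norm_ratio_aux σ x y hσ hx h4 hy j)
    have hne : ∀ τ : ℝ, 0 < ∏ j ∈ Finset.range (n+1), ‖(τ + y * I + j : ℂ)‖ := by
      intro τ
      apply Finset.prod_pos
      intro j _
      rw [norm_pos_iff]
      intro h
      have := congrArg Complex.im h
      simp at this; linarith
    have hexp : ((n:ℝ)^2/((n:ℝ)^2+y^2))^(x/2) * (y^x * Real.exp (-(C*x))) ≤ (n:ℝ)^x *
        Real.exp (-(x * ∑ j ∈ Finset.range (n+1), ((j:ℝ)+2)/((j:ℝ)^2+y^2))) := by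
      have hs := (sum_aux y hy n).trans (add_le_add_right (hC n) _)
      have h1 : ((n:ℝ)^2/((n:ℝ)^2+y^2))^(x/2) * (y^x * Real.exp (-(C*x))) =
          (n:ℝ)^x * Real.exp (-(x * ((1/2) * Real.log (((n:ℝ)^2+y^2)/y^2) + C))) := by
        rw [Real.rpow_def_of_pos (by positivity), Real.rpow_def_of_pos (by positivity),
          Real.rpow_def_of_pos (by positivity), ← Real.exp_add, ← Real.exp_add, ← Real.exp_add,
          Real.log_div (by positivity) (by positivity), Real.log_div (by positivity) (by positivity),
          Real.log_pow, Real.log_pow]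
        congr 1; push_cast; ring
      rw [h1]
      gcongr
    have g1 : ∀ τ : ℝ, ‖Complex.GammaSeq (τ + y*I) n‖ = (n:ℝ)^τ * (n.factorial : ℝ) /
        ∏ j ∈ Finset.range (n+1), ‖(τ + y * I + j : ℂ)‖ := by
      intro τ
      rw [Complex.GammaSeq, norm_div, norm_mul, norm_prod]
      congr 2
      · have : ‖((n:ℝ):ℂ) ^ (τ + y*I : ℂ)‖ = (n:ℝ)^τ := by
          rw [Complex.norm_cpow_eq_rpow_re_of_pos hn0]; simp
        simpa using this
      · simp
    have g2 := g1 (σ+x)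
    push_cast at g2
    have hne2 := hne (σ + x)
    push_cast at hne2
    rw [g1, g2, Real.rpow_add hn0, div_mul_eq_mul_div, div_le_div_iff₀ (hne _) hne2]
    calc _ ≤ (n:ℝ)^σ * n.factorial * ((n:ℝ)^x *
        Real.exp (-(x * ∑ j ∈ Finset.range (n+1), ((j:ℝ)+2)/((j:ℝ)^2+y^2)))) * ∏ j ∈ Finset.range (n+1), ‖(σ + x + y * I + j : ℂ)‖ := by
          gcongr
      _ = (n:ℝ)^σ * n.factorial * (n:ℝ)^x * ((∏ j ∈ Finset.range (n+1), ‖(σ + x + y * I + j : ℂ)‖) *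
        Real.exp (-(x * ∑ j ∈ Finset.range (n+1), ((j:ℝ)+2)/((j:ℝ)^2+y^2)))) := by ring
      _ ≤ (n:ℝ)^σ * n.factorial * (n:ℝ)^x * ∏ j ∈ Finset.range (n+1), ‖(σ + y * I + j : ℂ)‖ := by gcongr
      _ = _ := by ring
  have t1 : Tendsto (fun n : ℕ => ((n:ℝ)^2/((n:ℝ)^2+y^2))) atTop (𝓝 1) := by
    have : Tendsto (fun n : ℕ => 1 - y^2/((n:ℝ)^2+y^2)) atTop (𝓝 (1 - 0)) := by
      apply Tendsto.const_sub
      apply Tendsto.div_atTop tendsto_const_nhds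
      apply tendsto_atTop_add_const_right
      exact (tendsto_pow_atTop (by norm_num)).comp tendsto_natCast_atTop_atTop
    rw [sub_zero] at this
    refine this.congr (fun n => ?_)
    have : (n:ℝ)^2+y^2 ≠ 0 := by positivity
    field_simp; ring
  have t2 : Tendsto (fun n : ℕ => ((n:ℝ)^2/((n:ℝ)^2+y^2))^(x/2)) atTop (𝓝 1) := by
    simpa using t1.rpow_const (p := x/2) (Or.inl one_ne_zero)
  have L := ((Complex.GammaSeq_tendsto_Gamma (σ + y*I)).norm).mul (t2.mul_const (y^x * Real.exp (-(C*x))))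
  have R := (Complex.GammaSeq_tendsto_Gamma (σ + x + y*I)).norm
  rw [one_mul] at L
  exact le_of_tendsto_of_tendsto L R (by filter_upwards [eventually_ge_atTop 1] with n hn using key n hn)

/-- lower bound for `Γ(1/4+iy)` -/
lemma gamma_lower : ∃ c : ℝ, 0 < c ∧ ∀ y : ℝ, 1 ≤ y →
    c * (y^(-(1/4):ℝ) * Real.exp (-(Real.pi*y/2))) ≤ ‖Complex.Gamma (1/4 + y * I)‖ := by
  obtain ⟨C, hC0, hC⟩ := gamma_ratio
  refine ⟨Real.exp (-(C*(1/4))), Real.exp_pos _, fun y hy => ?_⟩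
  have hy0 : 0 < y := by linarith
  have h1 := hC (3/4) (1/2) y (by norm_num) (by norm_num) (by norm_num) hy
  have h2 : Complex.Gamma (((3/4:ℝ):ℂ) + ((1/2:ℝ):ℂ) + y*I) = (1/4 + y*I) * Complex.Gamma (1/4 + y*I) := by
    rw [← Complex.Gamma_add_one]
    · congr 1; push_cast; ring
    · intro h; have := congrArg Complex.im h; simp at this; linarith
  have h3 : ‖(1/4 + y*I : ℂ)‖ ≤ 2*y := by
    calc _ ≤ ‖(1/4:ℂ)‖ + ‖(y*I:ℂ)‖ := norm_add_le _ _
      _ = 1/4 + y := by simp [abs_of_pos hy0]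
      _ ≤ 2*y := by linarith
  have hrefl := Complex.Gamma_mul_Gamma_one_sub (1/4 + y*I)
  have hconj : ‖Complex.Gamma (1 - (1/4 + y*I))‖ = ‖Complex.Gamma (((3/4:ℝ):ℂ) + y*I)‖ := by
    rw [← Complex.norm_conj, ← Complex.Gamma_conj]
    congr 2
    apply Complex.ext <;> simp
    norm_num
  have hsin : ‖Complex.sin (Real.pi * (1/4 + y*I))‖ ≤ Real.exp (Real.pi*y) := by
    rw [Complex.sin]
    have a1 : ‖cexp (-(Real.pi * (1/4 + y*I)) * I)‖ = Real.exp (Real.pi*y) := by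
      rw [Complex.norm_exp]; simp
    have a2 : ‖cexp ((Real.pi * (1/4 + y*I)) * I)‖ = Real.exp (-(Real.pi*y)) := by
      rw [Complex.norm_exp]; simp
    rw [norm_div, norm_mul]
    simp only [Complex.norm_I, mul_one, Complex.norm_ofNat]
    have := norm_sub_le (cexp (-(Real.pi * (1/4 + y*I)) * I)) (cexp ((Real.pi * (1/4 + y*I)) * I))
    rw [a1, a2] at this
    have h5 : Real.exp (-(Real.pi*y)) ≤ Real.exp (Real.pi*y) := Real.exp_le_exp.mpr (by nlinarith [Real.pi_pos, mul_pos Real.pi_pos hy0])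
    linarith
  have hG0 : 0 < ‖Complex.sin (Real.pi * (1/4 + y*I))‖ := by
    rw [norm_pos_iff]
    intro h0
    rw [h0, div_zero] at hrefl
    rcases mul_eq_zero.mp hrefl with h | h
    · refine Complex.Gamma_ne_zero (fun m hm => ?_) h
      have := congrArg Complex.im hm; simp at this; linarith
    · refine Complex.Gamma_ne_zero (fun m hm => ?_) h
      have := congrArg Complex.im hm; simp at this; linarith
  have h6 : Real.pi * Real.exp (-(Real.pi*y)) ≤ ‖Complex.Gamma (1/4 + y*I)‖ * ‖Complex.Gamma (((3/4:ℝ):ℂ) + y*I)‖ := by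
    rw [← hconj, ← norm_mul, hrefl, norm_div, Real.exp_neg, ← div_eq_mul_inv]
    simp only [Complex.norm_real, Real.norm_eq_abs, abs_of_pos Real.pi_pos]
    gcongr
  set A := ‖Complex.Gamma (1/4 + y*I)‖ with hA
  set B := ‖Complex.Gamma (((3/4:ℝ):ℂ) + y*I)‖ with hB
  rw [h2, norm_mul] at h1
  have h7 : B * (y^(1/2:ℝ) * Real.exp (-(C*(1/2)))) ≤ 2*y*A := h1.trans (by gcongr)
  have hA0 : 0 ≤ A := norm_nonneg _
  apply le_of_sq_le_sq _ hA0
  have e1 : (Real.exp (-(C*(1/4))) * (y^(-(1/4):ℝ) * Real.exp (-(Real.pi*y/2))))^2 =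
      Real.exp (-(C*(1/2))) * (y^(-(1/2):ℝ) * Real.exp (-(Real.pi*y))) := by
    rw [mul_pow, mul_pow, ← Real.exp_nat_mul, ← Real.exp_nat_mul, ← Real.rpow_natCast, ← Real.rpow_mul hy0.le]
    have i1 : ((2:ℕ):ℝ) * -(C*(1/4)) = -(C*(1/2)) := by push_cast; ring
    have i2 : -(1/4:ℝ) * ((2:ℕ):ℝ) = -(1/2) := by norm_num
    have i3 : ((2:ℕ):ℝ) * -(Real.pi*y/2) = -(Real.pi*y) := by push_cast; ring
    rw [i1, i2, i3]
  rw [e1]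
  have e2 : y^(-(1/2):ℝ) * y = y^(1/2:ℝ) := by
    conv_lhs => rw [← Real.rpow_one y, ← Real.rpow_mul hy0.le, ← Real.rpow_add hy0]
    norm_num
  have hB0 : 0 ≤ B := norm_nonneg _
  have hyp : 0 < y^(1/2:ℝ) := by positivity
  have hE : 0 < Real.exp (-(C*(1/2))) := Real.exp_pos _
  have h8 : Real.pi * Real.exp (-(Real.pi*y)) * (y^(1/2:ℝ) * Real.exp (-(C*(1/2)))) ≤ A * (2*y*A) := by
    calc _ ≤ (A * B) * (y^(1/2:ℝ) * Real.exp (-(C*(1/2)))) := by gcongr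
      _ = A * (B * (y^(1/2:ℝ) * Real.exp (-(C*(1/2))))) := by ring
      _ ≤ _ := by gcongr
  rw [← e2] at h8
  have hZ : 0 ≤ Real.exp (-(Real.pi*y)) * y^(-(1/2):ℝ) * Real.exp (-(C*(1/2))) := by positivity
  have h9 : 2 * (Real.exp (-(Real.pi*y)) * y^(-(1/2):ℝ) * Real.exp (-(C*(1/2)))) ≤ 2 * A^2 := by
    have : Real.pi * (Real.exp (-(Real.pi*y)) * y^(-(1/2):ℝ) * Real.exp (-(C*(1/2)))) ≤ 2*A^2 := by
      refine le_of_mul_le_mul_right ?_ hy0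
      linarith
    nlinarith [Real.pi_gt_three]
  linarith


lemma zeta_eq {s : ℂ} (hs : s ≠ 0) (hre : 0 < s.re) : completedRiemannZeta s = Complex.Gammaℝ s * riemannZeta s := by
  rw [riemannZeta_def_of_ne_zero hs, mul_div_cancel₀]
  exact Complex.Gammaℝ_ne_zero_of_re_pos hre

lemma gammaR_conj (s : ℂ) : Complex.Gammaℝ (starRingEnd ℂ s) = starRingEnd ℂ (Complex.Gammaℝ s) := by
  rw [Complex.Gammaℝ_def, Complex.Gammaℝ_def, map_mul, ← Complex.Gamma_conj]
  congr 1
  · have := Complex.cpow_conj (Real.pi : ℂ) (-s/2) (by rw [Complex.arg_ofReal_of_nonneg Real.pi_pos.le]; exact Real.pi_pos.ne)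
    rw [Complex.conj_ofReal] at this
    rw [← this]
    congr 1; simp [map_div₀, map_ofNat (starRingEnd ℂ) 2]
  · congr 1; simp [map_div₀, map_ofNat (starRingEnd ℂ) 2]

lemma completed_conj {s : ℂ} (hs : s ≠ 0) (hre : 0 < s.re) :
    completedRiemannZeta (starRingEnd ℂ s) = starRingEnd ℂ (completedRiemannZeta s) := by
  rw [zeta_eq hs hre, zeta_eq (by simpa using hs) (by simpa using hre), gammaR_conj, riemannZeta_conj, map_mul]

lemma completed_real (t : ℝ) : completedRiemannZeta (1/2 + t * I) =
    ((completedRiemannZeta (1/2 + t * I)).re : ℂ) := by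
  symm
  rw [← Complex.conj_eq_iff_re, ← completed_conj, ← completedRiemannZeta_one_sub]
  · congr 1
    apply Complex.ext <;> simp
    norm_num
  · intro h; have := congrArg Complex.re h; simp at this
  · simp

lemma norm_gammaR (σ t : ℝ) : ‖Complex.Gammaℝ (σ + t*I)‖ = Real.pi^(-(σ/2)) * ‖Complex.Gamma ((σ/2:ℝ) + (t/2:ℝ)*I)‖ := by
  rw [Complex.Gammaℝ_def, norm_mul]
  congr 1
  · rw [Complex.norm_cpow_eq_rpow_re_of_pos Real.pi_pos]; simp; ring_nf
  · congr 2; push_cast; ring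

lemma refl_ineq : ∃ T : ℝ, 16 ≤ T ∧ ∀ t : ℝ, T ≤ t → 0 < 2 / Real.log t ∧ 2/Real.log t ≤ 1/8 ∧
    ‖riemannZeta (1/2 + (2/Real.log t : ℝ) + t*I)‖ ≤ (1/2)*‖riemannZeta (1/2 - (2/Real.log t : ℝ) + t*I)‖ := by
  obtain ⟨C, hC0, hC⟩ := gamma_ratio
  have hlim : Tendsto (fun t : ℝ => 2 / Real.log t) atTop (𝓝 0) :=
    Tendsto.div_atTop tendsto_const_nhds Real.tendsto_log_atTop
  have hlim2 : Tendsto (fun t : ℝ => (2 / Real.log t) * (C + Real.log (2*Real.pi))) atTop (𝓝 0) := by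
    simpa using hlim.mul_const (C + Real.log (2*Real.pi))
  have hev := ((hlim.eventually (ge_mem_nhds (show (0:ℝ) < 1/8 by norm_num))).and
    (hlim2.eventually (ge_mem_nhds (show (0:ℝ) < 1 by norm_num)))).and (eventually_ge_atTop (16:ℝ))
  obtain ⟨T, hT⟩ := eventually_atTop.mp hev
  refine ⟨max T 16, le_max_right _ _, fun t ht => ?_⟩
  obtain ⟨⟨h1, h2⟩, h16⟩ := hT t ((le_max_left _ _).trans ht)
  have hlog : 0 < Real.log t := Real.log_pos (by linarith)
  set x := 2 / Real.log t with hx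
  have hx0 : 0 < x := by positivity
  refine ⟨hx0, h1, ?_⟩
  have hsym : ‖completedRiemannZeta (1/2 + x + t*I)‖ = ‖completedRiemannZeta (1/2 - x + t*I)‖ := by
    rw [← completedRiemannZeta_one_sub, ← Complex.norm_conj, ← completed_conj]
    · congr 2
      apply Complex.ext <;> simp
      norm_num
      ring
    · intro h; have := congrArg Complex.im h; simp at this; linarith
    · simp; norm_num; linarith
  rw [zeta_eq, zeta_eq, norm_mul, norm_mul] at hsym
  rotate_left
  · intro h; have := congrArg Complex.im h; simp at this; linarith
  · simp; norm_num; linarith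
  · intro h; have := congrArg Complex.im h; simp at this; linarith
  · simp; norm_num; linarith
  have n1 := norm_gammaR (1/2+x) t
  have n2 := norm_gammaR (1/2-x) t
  push_cast at n1 n2
  rw [n1, n2] at hsym
  have hr := hC (1/4 - x/2) x (t/2) (by linarith) hx0.le (by linarith) (by linarith)
  have i1 : (((1/4 - x/2 : ℝ)):ℂ) + x + ((t/2:ℝ):ℂ) * I = (1/2 + x)/2 + t/2*I := by push_cast; ring
  have i2 : (((1/4 - x/2 : ℝ)):ℂ) + ((t/2:ℝ):ℂ) * I = (1/2 - x)/2 + t/2*I := by push_cast; ring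
  rw [i1, i2] at hr
  set A := ‖Complex.Gamma ((1/2 + x)/2 + t/2*I)‖ with hA
  set B := ‖Complex.Gamma ((1/2 - x)/2 + t/2*I)‖ with hB
  set P := ‖riemannZeta (1/2 + x + t*I)‖ with hP
  set Q := ‖riemannZeta (1/2 - x + t*I)‖ with hQ
  have hBpos : 0 < B := by
    rw [hB, norm_pos_iff]
    refine Complex.Gamma_ne_zero (fun m hm => ?_)
    have := congrArg Complex.im hm; simp at this; linarith
  have hπ : Real.pi^(-((1/2-x)/2)) = Real.pi^(-((1/2+x)/2)) * Real.pi^x := by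
    rw [← Real.rpow_add Real.pi_pos]; congr 1; ring
  rw [hπ] at hsym
  have hππ : 0 < Real.pi^(-((1/2+x)/2)) := by positivity
  have h3 : A * P = Real.pi^x * B * Q := by
    apply mul_left_cancel₀ hππ.ne'; linarith
  have hQ0 : 0 ≤ Q := norm_nonneg _
  have hP0 : 0 ≤ P := norm_nonneg _
  have h4 : B * ((t/2)^x * Real.exp (-(C*x))) * P ≤ Real.pi^x * B * Q := by
    rw [← h3]; gcongr
  have h5 : ((t/2)^x * Real.exp (-(C*x))) * P ≤ Real.pi^x * Q := by
    apply le_of_mul_le_mul_left _ hBpos; linarith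
  have h6 : 2 * Real.pi^x ≤ (t/2)^x * Real.exp (-(C*x)) := by
    have e2 : (2:ℝ) ≤ Real.exp 1 := by linarith [Real.add_one_le_exp (1:ℝ)]
    calc 2 * Real.pi^x ≤ Real.exp 1 * Real.pi^x := by gcongr
      _ = Real.exp (1 + x * Real.log Real.pi) := by
        rw [Real.exp_add, Real.rpow_def_of_pos Real.pi_pos, mul_comm x]
      _ ≤ Real.exp (x * Real.log t - x * Real.log 2 - C * x) := by
        apply Real.exp_le_exp.mpr
        rw [Real.log_mul (by norm_num) Real.pi_pos.ne'] at h2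
        have : x * Real.log t = 2 := by rw [hx]; field_simp
        linarith
      _ = _ := by
        rw [Real.rpow_def_of_pos (by linarith), ← Real.exp_add, Real.log_div (by linarith) (by norm_num)]
        congr 1; ring
  have hpx : 0 < Real.pi^x := by positivity
  have h7 : 2 * Real.pi^x * P ≤ Real.pi^x * Q := le_trans (by gcongr) h5
  have h8 : 2 * P ≤ Q := by
    apply le_of_mul_le_mul_left _ hpx; linarith
  linarith

lemma completed0_bound : ∃ C : ℝ, ∀ s : ℂ, 1/2 ≤ s.re → s.re ≤ 4 → ‖completedRiemannZeta₀ s‖ ≤ C := by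
  set P := HurwitzZeta.hurwitzEvenFEPair 0
  have hconv : ∀ s : ℂ, MellinConvergent P.f_modif s := fun s =>
    (P.isStrongFEPair_toStrongFEPair.hasMellin s).1
  refine ⟨(∫ t in Ioi (0:ℝ), (‖(t:ℂ)^((1/4:ℂ)-1) • P.f_modif t‖ + ‖(t:ℂ)^((2:ℂ)-1) • P.f_modif t‖)) / 2, fun s h1 h2 => ?_⟩
  have : completedRiemannZeta₀ s = mellin P.f_modif (s/2) / 2 := rfl
  rw [this, norm_div, Complex.norm_ofNat]
  gcongr
  rw [mellin]
  refine MeasureTheory.norm_integral_le_of_norm_le ((hconv (1/4)).norm.add (hconv 2).norm) ?_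
  filter_upwards [MeasureTheory.ae_restrict_mem measurableSet_Ioi] with t ht
  have ht0 : 0 < t := ht
  simp only [norm_smul, ← add_mul, Complex.norm_cpow_eq_rpow_re_of_pos ht0]
  gcongr
  rcases le_total t 1 with h | h
  · have : t ^ (s/2-1).re ≤ t ^ ((1/4:ℂ)-1).re := by
      apply Real.rpow_le_rpow_of_exponent_ge ht0 h
      norm_num
      linarith
    exact le_add_of_le_of_nonneg this (by positivity)
  · have : t ^ (s/2-1).re ≤ t ^ ((2:ℂ)-1).re := by
      apply Real.rpow_le_rpow_of_exponent_le h
      norm_num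
      linarith
    exact le_add_of_nonneg_of_le (by positivity) this

lemma zeta_growth : ∃ C : ℝ, 0 < C ∧ ∀ σ t : ℝ, 1/2 ≤ σ → σ ≤ 4 → 2 ≤ t →
    ‖riemannZeta (σ + t*I)‖ ≤ C * Real.exp (2*t) := by
  obtain ⟨C₀, h0⟩ := completed0_bound
  obtain ⟨C₁, hC1, h1⟩ := gamma_ratio
  obtain ⟨c, hc, h2⟩ := gamma_lower
  have hC00 : 0 ≤ C₀ := (norm_nonneg _).trans (h0 1 (by norm_num) (by norm_num))
  refine ⟨(C₀+2)/(Real.pi^(-(2:ℝ)) * (c * Real.exp (-(C₁*2)))), by positivity, fun σ t hσ hσ' ht => ?_⟩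
  have hs0 : (σ + t*I : ℂ) ≠ 0 := by
    intro h; have := congrArg Complex.im h; simp at this; linarith
  rw [riemannZeta_def_of_ne_zero hs0, norm_div, norm_gammaR, div_mul_eq_mul_div]
  have hnum : ‖completedRiemannZeta (σ + t*I)‖ ≤ C₀ + 2 := by
    rw [completedRiemannZeta_eq]
    have a1 : ‖(1:ℂ)/(σ + t*I)‖ ≤ 1 := by
      rw [norm_div, norm_one]
      apply div_le_one_of_le₀ _ (norm_nonneg _)
      have := Complex.abs_im_le_norm (σ + t*I)
      simp at this
      linarith [le_abs_self t]
    have a2 : ‖(1:ℂ)/(1-(σ + t*I))‖ ≤ 1 := by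
      rw [norm_div, norm_one]
      apply div_le_one_of_le₀ _ (norm_nonneg _)
      have := Complex.abs_im_le_norm (1-(σ + t*I))
      simp at this
      linarith [le_abs_self t]
    have a3 := h0 (σ + t*I) (by simpa using hσ) (by simpa using hσ')
    calc _ ≤ ‖completedRiemannZeta₀ (σ + t*I)‖ + ‖(1:ℂ)/(σ + t*I)‖ + ‖(1:ℂ)/(1-(σ + t*I))‖ :=
          (norm_sub_le _ _).trans (by gcongr; exact norm_sub_le _ _)
      _ ≤ C₀+2 := by linarith
  have hx := h1 (1/4) (σ/2-1/4) (t/2) (by norm_num) (by linarith) (by linarith) (by linarith)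
  have hg := h2 (t/2) (by linarith)
  have i1 : ((1/4:ℝ):ℂ) + ((σ/2-1/4:ℝ):ℂ) + ((t/2:ℝ):ℂ) * I = ((σ/2:ℝ):ℂ) + ((t/2:ℝ):ℂ)*I := by push_cast; ring
  rw [i1] at hx
  have i2 : ((1/4:ℝ):ℂ) = 1/4 := by push_cast; ring
  rw [i2] at hx
  have hpow : 1 ≤ (t/2)^(σ/2-1/4) := Real.one_le_rpow (by linarith) (by linarith)
  have hexp : Real.exp (-(C₁*2)) ≤ Real.exp (-(C₁*(σ/2-1/4))) := by
    apply Real.exp_le_exp.mpr; nlinarith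
  have hlow : Real.exp (-(2*t)) ≤ (t/2)^(-(1/4):ℝ) * Real.exp (-(Real.pi*(t/2)/2)) := by
    have : Real.exp (-t) ≤ (t/2)^(-(1/4):ℝ) := by
      rw [Real.rpow_def_of_pos (by linarith)]
      apply Real.exp_le_exp.mpr
      have := Real.log_le_sub_one_of_pos (show 0 < t/2 by linarith)
      linarith
    have h' : Real.exp (-t) ≤ Real.exp (-(Real.pi*(t/2)/2)) := by
      apply Real.exp_le_exp.mpr
      nlinarith [Real.pi_le_four]
    calc Real.exp (-(2*t)) = Real.exp (-t) * Real.exp (-t) := by rw [← Real.exp_add]; congr 1; ring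
      _ ≤ _ := by gcongr
  have hπ : Real.pi^(-(2:ℝ)) ≤ Real.pi^(-(σ/2)) := by
    apply Real.rpow_le_rpow_of_exponent_le
    · linarith [Real.pi_gt_three]
    · linarith
  have hden : Real.pi^(-(2:ℝ)) * (c * Real.exp (-(C₁*2))) * Real.exp (-(2*t)) ≤
      Real.pi^(-(σ/2)) * ‖Complex.Gamma ((σ/2:ℝ) + (t/2:ℝ)*I)‖ := by
    calc _ = Real.pi^(-(2:ℝ)) * ((c * Real.exp (-(2*t))) * (1 * Real.exp (-(C₁*2)))) := by ring
      _ ≤ Real.pi^(-(σ/2)) * (‖Complex.Gamma (1/4 + (t/2:ℝ)*I)‖ * ((t/2)^(σ/2-1/4) * Real.exp (-(C₁*(σ/2-1/4))))) := by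
        gcongr
        exact le_trans (by gcongr) hg
      _ ≤ _ := by gcongr
  have : Real.exp (2*t) = 1 / Real.exp (-(2*t)) := by rw [Real.exp_neg]; simp
  rw [this, mul_one_div, div_div]
  exact div_le_div₀ (by positivity) hnum (by positivity) (by rw [mul_comm]; exact hden)

lemma zeta_sub_one_le {s : ℂ} (hs : 2 ≤ s.re) : ‖riemannZeta s - 1‖ ≤ 13/20 := by
  rw [zeta_eq_tsum_one_div_nat_add_one_cpow (by linarith)]
  have hz := hasSum_zeta_two
  have hz1 : HasSum (fun n : ℕ => 1/((n:ℝ)+1)^2) (Real.pi^2/6) := by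
    have := (hasSum_nat_add_iff' 1).mpr hz
    simpa using this
  have hb : ∀ n : ℕ, ‖(1:ℂ)/((n:ℂ)+1)^s‖ ≤ 1/((n:ℝ)+1)^2 := by
    intro n
    have h0 : (0:ℝ) < (n:ℝ)+1 := by positivity
    have e : ((n:ℂ)+1) = (((n:ℝ)+1 : ℝ) : ℂ) := by push_cast; ring
    rw [norm_div, norm_one, e, Complex.norm_cpow_eq_rpow_re_of_pos h0]
    apply one_div_le_one_div_of_le (by positivity)
    rw [← Real.rpow_natCast]
    apply Real.rpow_le_rpow_of_exponent_le (by linarith [n.cast_nonneg (α := ℝ)])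
    push_cast; exact hs
  have hsum : Summable (fun n : ℕ => (1:ℂ)/((n:ℂ)+1)^s) :=
    Summable.of_norm_bounded hz1.summable hb
  rw [hsum.tsum_eq_zero_add]
  have hz2 := (hasSum_nat_add_iff' 1).mpr hz1
  simp only [Nat.cast_zero, zero_add, Complex.one_cpow, div_one, add_sub_cancel_left]
  refine (tsum_of_norm_bounded hz2 (fun n => hb (n+1))).trans ?_
  simp
  have : Real.pi < 3.1416 := Real.pi_lt_d4
  nlinarith [Real.pi_pos]


lemma norm_exp_aux (s s0 : ℂ) : ‖cexp ((s-s0)^2/4) * cexp (-2*(s-2))‖ =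
    Real.exp (((s.re-s0.re)^2 - (s.im-s0.im)^2)/4 - 2*(s.re-2)) := by
  rw [← Complex.exp_add, Complex.norm_exp]
  congr 1
  have e : (s-s0)^2/4 = ((1/4:ℝ):ℂ) * ((s-s0)*(s-s0)) := by push_cast; ring
  have e' : -2*(s-2) = ((-2:ℝ):ℂ) * (s-2) := by push_cast; ring
  rw [e, e', Complex.add_re, Complex.re_ofReal_mul, Complex.re_ofReal_mul, Complex.mul_re]
  simp
  ring

lemma not_small (T : ℝ) (hT : ∀ t : ℝ, T ≤ t → ‖riemannZeta (1/2 + t*I)‖ ≤ 1/1000) : False := by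
  wlog hT2 : 2 ≤ T generalizing T
  · exact this (max T 2) (fun t ht => hT t ((le_max_left _ _).trans ht)) (le_max_right _ _)
  obtain ⟨C, hC, hg⟩ := zeta_growth
  obtain ⟨h, hh⟩ : ∃ h : ℝ, 20 ≤ h ∧ C * Real.exp (4*T+4-h) ≤ 1/10 := by
    refine ⟨max 20 (4*T+4+Real.log (10*C)), le_max_left _ _, ?_⟩
    calc _ ≤ C * Real.exp (-Real.log (10*C)) := by
          gcongr
          have := le_max_right 20 (4*T+4+Real.log (10*C))
          linarith
      _ = 1/10 := by rw [Real.exp_neg, Real.exp_log (by positivity)]; field_simp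
  obtain ⟨hh, hCh⟩ := hh
  set s0 : ℂ := 2 + ((T+h:ℝ):ℂ)*I with hs0
  have hs0re : s0.re = 2 := by simp [hs0]
  have hs0im : s0.im = T+h := by simp [hs0]
  set F : ℂ → ℂ := fun s => riemannZeta s * (cexp ((s-s0)^2/4) * cexp (-2*(s-2))) with hF
  set U : Set ℂ := Ioo (1/2:ℝ) 4 ×ℂ Ioo T (T+2*h) with hU
  have hcl : closure U = Icc (1/2:ℝ) 4 ×ℂ Icc T (T+2*h) := by
    rw [hU, Complex.closure_reProdIm, closure_Ioo (by norm_num), closure_Ioo (by linarith)]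
  have hdiff : DiffContOnCl ℂ F U := by
    apply DifferentiableOn.diffContOnCl
    rw [hcl]
    intro z hz
    have hz1 : z ≠ 1 := by
      rintro rfl
      have := hz.2.1
      simp at this
      linarith
    apply DifferentiableAt.differentiableWithinAt
    apply DifferentiableAt.mul (differentiableAt_riemannZeta hz1)
    fun_prop
  have hbd : Bornology.IsBounded U := by
    rw [hU]
    exact (Metric.isBounded_Ioo _ _).reProdIm (Metric.isBounded_Ioo _ _)
  have hfr : ∀ z ∈ frontier U, ‖F z‖ ≤ 1/10 := by
    intro z hz
    rw [hU, Complex.frontier_reProdIm, closure_Ioo (by norm_num), closure_Ioo (by linarith),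
      frontier_Ioo (by linarith), frontier_Ioo (by norm_num)] at hz
    rw [hF]
    simp only
    rw [norm_mul, norm_exp_aux, hs0re, hs0im]
    have hzz : z = z.re + z.im * I := (Complex.re_add_im z).symm
    have key : z.re ∈ Icc (1/2:ℝ) 4 → T ≤ z.im → z.im ≤ T+2*h → (z.im - (T+h))^2 = h^2 →
      ‖riemannZeta z‖ * Real.exp (((z.re-2)^2 - (z.im-(T+h))^2)/4 - 2*(z.re-2)) ≤ 1/10 := by
      intro h1 h2 h2' h3
      rw [h3]
      calc _ ≤ (C * Real.exp (2*z.im)) * Real.exp (((z.re-2)^2 - h^2)/4 - 2*(z.re-2)) := by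
            gcongr
            conv_lhs => rw [hzz]
            exact hg _ _ h1.1 h1.2 (by linarith)
        _ = C * Real.exp (2*z.im + (((z.re-2)^2 - h^2)/4 - 2*(z.re-2))) := by
            rw [mul_assoc, ← Real.exp_add]
        _ ≤ C * Real.exp (4*T+4-h) := by
            gcongr
            have := h1.1
            have := h1.2
            nlinarith
        _ ≤ 1/10 := hCh
    rcases hz with hz | hz
    · obtain ⟨h1, h2⟩ := hz
      rcases h2 with h2 | h2
      · exact key h1 (by simp [h2]) (by rw [show z.im = T from h2]; linarith) (by rw [show z.im = T from h2]; ring)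
      · exact key h1 (by rw [show z.im = T+2*h from h2]; linarith) (by simp [show z.im = T+2*h from h2]) (by rw [show z.im = T+2*h from h2]; ring)
    · obtain ⟨h1, h2⟩ := hz
      rcases h1 with h1 | h1
      · have h1' : z.re = 1/2 := h1
        have : ‖riemannZeta z‖ ≤ 1/1000 := by
          rw [hzz, h1']
          have := hT z.im h2.1
          push_cast
          exact this
        have hexp : Real.exp (((z.re-2)^2 - (z.im-(T+h))^2)/4 - 2*(z.re-2)) ≤ Real.exp 1 ^ 4 := by
          rw [← Real.exp_nat_mul]
          apply Real.exp_le_exp.mpr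
          rw [h1']; push_cast
          nlinarith [sq_nonneg (z.im-(T+h))]
        have he : Real.exp 1 ^ 4 ≤ 3^4 := by
          gcongr; linarith [Real.exp_one_lt_d9]
        calc _ ≤ (1/1000:ℝ) * 3^4 := by gcongr; exact hexp.trans he
          _ ≤ 1/10 := by norm_num
      · have h1' : z.re = 4 := h1
        have : ‖riemannZeta z‖ ≤ 33/20 := by
          have := zeta_sub_one_le (s := z) (by rw [h1']; norm_num)
          have h3 := norm_add_le (riemannZeta z - 1) 1
          rw [sub_add_cancel, norm_one] at h3
          linarith
        have hexp : Real.exp (((z.re-2)^2 - (z.im-(T+h))^2)/4 - 2*(z.re-2)) ≤ (Real.exp 1 ^ 3)⁻¹ := by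
          rw [← Real.exp_nat_mul, ← Real.exp_neg]
          apply Real.exp_le_exp.mpr
          rw [h1']; push_cast
          nlinarith [sq_nonneg (z.im-(T+h))]
        have he : (Real.exp 1 ^ 3)⁻¹ ≤ ((2.7:ℝ)^3)⁻¹ := by
          gcongr; linarith [Real.exp_one_gt_d9]
        calc _ ≤ (33/20:ℝ) * ((2.7:ℝ)^3)⁻¹ := by gcongr; exact hexp.trans he
          _ ≤ 1/10 := by norm_num
  have hs0mem : s0 ∈ closure U := by
    rw [hcl]
    exact ⟨by rw [Set.mem_preimage, hs0re]; norm_num, by rw [Set.mem_preimage, hs0im]; constructor <;> linarith⟩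
  have hfin := Complex.norm_le_of_forall_mem_frontier_norm_le hbd hdiff hfr hs0mem
  rw [hF] at hfin
  simp only at hfin
  rw [norm_mul, norm_exp_aux, hs0re] at hfin
  simp at hfin
  have h5 := zeta_sub_one_le (s := s0) (by rw [hs0re])
  have h3 := norm_sub_norm_le (1:ℂ) (riemannZeta s0)
  rw [norm_one, norm_sub_rev] at h3
  norm_num at hfin
  linarith

/-- algebraic core of the normal family step -/
lemma alg_core {a p q r : ℂ} {B κ ρ : ℝ} (hκ : 0 < κ) (hB : 0 < B) (hρ : 0 ≤ ρ)
    (hp : p ≠ a) (hq : q ≠ a) (hr : r ≠ a)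
    (h1 : ‖(q-a)⁻¹ - (p-a)⁻¹‖ ≤ ρ) (h2 : ‖(r-a)⁻¹ - (p-a)⁻¹‖ ≤ ρ)
    (h3 : ‖q‖ ≤ (1/2)*‖r‖) (hρ1 : ρ*(B+‖a‖) ≤ 1/2) (hρ2 : 6*ρ*(B+‖a‖)^2 ≤ κ) (hpB : ‖p‖ ≤ B) :
    ‖p‖ ≤ κ := by
  set D := B + ‖a‖ with hD
  have hD0 : 0 < D := by positivity
  have hpD : ‖p-a‖ ≤ D := (norm_sub_le _ _).trans (by linarith)
  have key : ∀ w : ℂ, w ≠ a → ‖(w-a)⁻¹ - (p-a)⁻¹‖ ≤ ρ → ‖w-p‖ ≤ 2*ρ*D^2 := by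
    intro w hw hwρ
    have hw' : w - a ≠ 0 := sub_ne_zero.mpr hw
    have hp' : p - a ≠ 0 := sub_ne_zero.mpr hp
    have e : w - p = -((w-a)⁻¹ - (p-a)⁻¹) * ((p-a)*(w-a)) := by
      field_simp; ring
    have : ‖w-p‖ ≤ ρ * (D * ‖w-a‖) := by
      conv_lhs => rw [e]
      rw [norm_mul, norm_neg, norm_mul]
      gcongr
    have h4 : ‖w-a‖ ≤ ‖w-p‖ + D := by
      have := norm_add_le (w-p) (p-a)
      rw [sub_add_sub_cancel] at this
      linarith
    have h5 : ρ * (D * ‖w-a‖) ≤ ρ * (D * (‖w-p‖ + D)) := by gcongr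
    have h6 : ρ * D * ‖w-p‖ ≤ 1/2 * ‖w-p‖ := by gcongr
    nlinarith
  have kq := key q hq h1
  have kr := key r hr h2
  have n1 : ‖p‖ - ‖q‖ ≤ ‖q-p‖ := by rw [norm_sub_rev]; exact norm_sub_norm_le _ _
  have n2 : ‖r‖ - ‖p‖ ≤ ‖r-p‖ := norm_sub_norm_le _ _
  linarith

lemma dichotomy (a : ℂ) (δ : ℝ) (hδ : 0 < δ) : ∃ M : ℝ, 0 < M ∧ ∀ T₀ : ℝ,
    (∀ t x : ℝ, T₀ ≤ t → |x| ≤ M / Real.log t → δ ≤ ‖riemannZeta (1/2 + x + t*I) - a‖) →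
    ∃ T : ℝ, ∀ t : ℝ, T ≤ t → ‖riemannZeta (1/2 + t*I)‖ ≤ 1/1000 ∨ 1 < ‖riemannZeta (1/2 + t*I)‖ := by
  set D := 1 + ‖a‖ with hD
  have hD1 : 1 ≤ D := by have := norm_nonneg a; linarith
  set ρ : ℝ := 1/(6000*D^2) with hρ
  have hρ0 : 0 < ρ := by positivity
  set M' : ℝ := 4/(δ*ρ) + 3 with hM'
  have hM'0 : 0 < M' := by positivity
  refine ⟨2*M', by positivity, fun T₀ hT₀ => ?_⟩
  obtain ⟨T₁, hT₁, hrefl⟩ := refl_ineq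
  have hlim : Tendsto (fun t : ℝ => M' / Real.log t) atTop (𝓝 0) :=
    Tendsto.div_atTop tendsto_const_nhds Real.tendsto_log_atTop
  obtain ⟨T₂, hT₂⟩ := eventually_atTop.mp (hlim.eventually (ge_mem_nhds (show (0:ℝ) < 1 by norm_num)))
  refine ⟨max (T₀+1) (max T₁ T₂), fun t ht => ?_⟩
  have htT₀ : T₀ + 1 ≤ t := (le_max_left _ _).trans ht
  have htT₁ : T₁ ≤ t := ((le_max_left _ _).trans (le_max_right _ _)).trans ht
  have htT₂ : T₂ ≤ t := ((le_max_right _ _).trans (le_max_right _ _)).trans ht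
  have ht16 : 16 ≤ t := hT₁.trans htT₁
  obtain ⟨hx0, hx8, hxr⟩ := hrefl t htT₁
  have hlog : 0 < Real.log t := Real.log_pos (by linarith)
  set x := 2/Real.log t with hx
  set r := M'/Real.log t with hr
  have hr1 : r ≤ 1 := hT₂ t htT₂
  have hr0 : 0 < r := by positivity
  have hxr' : x < r := by
    rw [hx, hr]; apply div_lt_div_of_pos_right _ hlog
    have : 0 < 4/(δ*ρ) := by positivity
    linarith
  set s0 : ℂ := 1/2 + t*I with hs0
  have hball : ∀ z ∈ Metric.ball s0 r, z ≠ 1 ∧ δ ≤ ‖riemannZeta z - a‖ := by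
    intro z hz
    rw [mem_ball_iff_norm] at hz
    have him := (Complex.abs_im_le_norm (z - s0)).trans_lt hz
    have hre := (Complex.abs_re_le_norm (z - s0)).trans_lt hz
    simp [hs0] at him hre
    have him' := abs_lt.mp him
    refine ⟨?_, ?_⟩
    · rintro rfl; simp at him'; linarith [him'.1]
    · have := hT₀ z.im (z.re - 1/2) (by linarith [him'.1]) (by
        have hl : Real.log z.im ≤ 2 * Real.log t := by
          rw [← Real.log_rpow (by linarith)]
          apply Real.log_le_log (by linarith [him'.1])
          rw [show ((2:ℝ)) = ((2:ℕ):ℝ) by norm_num, Real.rpow_natCast]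
          nlinarith [him'.2]
        have hl0 : 0 < Real.log z.im := Real.log_pos (by linarith [him'.1])
        have : r ≤ 2*M'/Real.log z.im := by
          rw [hr, div_le_div_iff₀ hlog hl0]
          nlinarith
        refine le_trans ?_ this
        have h9 : z.re - 1/2 = z.re - 2⁻¹ := by norm_num
        rw [h9]
        exact hre.le)
      have e : (1/2 + ((z.re - 1/2 : ℝ):ℂ) + z.im * I : ℂ) = z := by
        conv_rhs => rw [← Complex.re_add_im z]
        push_cast; ring
      rwa [e] at this
  set g : ℂ → ℂ := fun z => (riemannZeta z - a)⁻¹ with hg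
  have hne : ∀ z ∈ Metric.ball s0 r, riemannZeta z - a ≠ 0 := by
    intro z hz h
    have := (hball z hz).2
    rw [h, norm_zero] at this; linarith
  have hgd : DifferentiableOn ℂ g (Metric.ball s0 r) := by
    intro z hz
    apply DifferentiableAt.differentiableWithinAt
    have hd : DifferentiableAt ℂ (fun z => riemannZeta z - a) z :=
      (differentiableAt_riemannZeta (hball z hz).1).sub_const a
    exact hd.fun_inv (hne z hz)
  have hgb : ∀ z ∈ Metric.ball s0 r, ‖g z‖ ≤ 1/δ := by
    intro z hz
    rw [hg]; simp only
    rw [norm_inv, ← one_div]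
    exact one_div_le_one_div_of_le hδ (hball z hz).2
  have hc : s0 ∈ Metric.ball s0 r := Metric.mem_ball_self hr0
  have hmaps : MapsTo g (Metric.ball s0 r) (Metric.closedBall (g s0) (2/δ)) := by
    intro z hz
    rw [mem_closedBall_iff_norm]
    calc _ ≤ ‖g z‖ + ‖g s0‖ := norm_sub_le _ _
      _ ≤ 1/δ + 1/δ := add_le_add (hgb z hz) (hgb s0 hc)
      _ = 2/δ := by ring
  have hsch : ∀ z, ‖z - s0‖ = x → z ∈ Metric.ball s0 r ∧ ‖g z - g s0‖ ≤ ρ := by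
    intro z hz
    have hzb : z ∈ Metric.ball s0 r := by rw [mem_ball_iff_norm, hz]; exact hxr'
    refine ⟨hzb, ?_⟩
    have := Complex.dist_le_div_mul_dist_of_mapsTo_ball hgd hmaps hzb
    rw [dist_eq_norm, dist_eq_norm, hz] at this
    refine this.trans ?_
    have : 2/δ/r*x = 4/(δ*M') := by rw [hx, hr]; field_simp; ring
    rw [this, div_le_iff₀ (by positivity)]
    have h4 : ρ * (δ * M') = 4 + 3*(ρ*δ) := by rw [hM']; field_simp
    rw [h4]
    have : 0 < ρ*δ := by positivity
    linarith
  obtain ⟨b1, k1⟩ := hsch (1/2 + x + t*I) (by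
    rw [show (1/2 + x + t*I - s0 : ℂ) = (x:ℂ) by rw [hs0]; ring, Complex.norm_real, Real.norm_eq_abs, abs_of_pos hx0])
  obtain ⟨b2, k2⟩ := hsch (1/2 - x + t*I) (by
    rw [show (1/2 - x + t*I - s0 : ℂ) = -(x:ℂ) by rw [hs0]; ring, norm_neg, Complex.norm_real, Real.norm_eq_abs, abs_of_pos hx0])
  by_cases hp : ‖riemannZeta s0‖ ≤ 1
  · left
    refine alg_core (a := a) (B := 1) (ρ := ρ) (by norm_num) one_pos hρ0.le (sub_ne_zero.mp (hne s0 hc)) (sub_ne_zero.mp (hne _ b1))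
      (sub_ne_zero.mp (hne _ b2)) k1 k2 hxr ?_ ?_ hp
    · rw [← hD, hρ, div_mul_eq_mul_div, div_le_div_iff₀ (by positivity) (by norm_num)]
      nlinarith
    · rw [← hD, hρ]
      apply le_of_eq; field_simp; norm_num
  · right; push Not at hp; exact hp

lemma small_or_large (a : ℂ) (δ : ℝ) (hδ : 0 < δ) : ∃ M : ℝ, 0 < M ∧ ∀ T₀ : ℝ,
    (∀ t x : ℝ, T₀ ≤ t → |x| ≤ M / Real.log t → δ ≤ ‖riemannZeta (1/2 + x + t*I) - a‖) →
    ∃ T : ℝ, ∀ t : ℝ, T ≤ t → 1 < ‖riemannZeta (1/2 + t*I)‖ := by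
  obtain ⟨M, hM, h⟩ := dichotomy a δ hδ
  refine ⟨M, hM, fun T₀ hT₀ => ?_⟩
  obtain ⟨T, hT⟩ := h T₀ hT₀
  have hcont : Continuous (fun t : ℝ => ‖riemannZeta (1/2 + t*I)‖) := by
    rw [continuous_iff_continuousAt]
    intro t
    apply ContinuousAt.norm
    have h1 : (1/2 + t*I : ℂ) ≠ 1 := by
      intro h; have := congrArg Complex.re h; norm_num at this
    exact ContinuousAt.comp (f := fun t : ℝ => (1/2 + t*I : ℂ)) (differentiableAt_riemannZeta h1).continuousAt (by fun_prop)
  by_contra hcon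
  push Not at hcon
  obtain ⟨t₁, ht₁, h1⟩ := hcon T
  have h1' : ‖riemannZeta (1/2 + t₁*I)‖ ≤ 1/1000 := (hT t₁ ht₁).resolve_right (by linarith)
  refine not_small t₁ (fun t ht => ?_)
  rcases hT t (ht₁.trans ht) with h2 | h2
  · exact h2
  · exfalso
    obtain ⟨u, hu, hu'⟩ := intermediate_value_Icc ht hcont.continuousOn
      (show (1/2:ℝ) ∈ Icc _ _ from ⟨by linarith, by linarith⟩)
    simp only at hu'
    rcases hT u (ht₁.trans hu.1) with h3 | h3 <;> linarith


/-- The theta kernel whose Fourier transform is the completed zeta function. -/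
noncomputable def kk (w : ℂ) : ℂ :=
  cexp (w/2) * (jacobiTheta (I * cexp (2*w)) - 1 - cexp (-w))

lemma kk_im (w : ℂ) : (I * cexp (2*w)).im = Real.exp (2*w.re) * Real.cos (2*w.im) := by
  simp [Complex.mul_im, Complex.exp_re]

lemma kk_cos_pos {v : ℝ} (h : |v| < Real.pi/4) : 0 < Real.cos (2*v) := by
  have := abs_lt.1 h
  exact Real.cos_pos_of_mem_Ioo ⟨by linarith, by linarith⟩

lemma kk_im_pos {w : ℂ} (h : |w.im| < Real.pi/4) : 0 < (I * cexp (2*w)).im := by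
  rw [kk_im]; exact mul_pos (Real.exp_pos _) (kk_cos_pos h)

lemma kk_diff {w : ℂ} (h : |w.im| < Real.pi/4) : DifferentiableAt ℂ kk w := by
  unfold kk
  have h1 : DifferentiableAt ℂ (fun w => jacobiTheta (I * cexp (2*w))) w := by
    have := differentiableAt_jacobiTheta (kk_im_pos h)
    exact DifferentiableAt.comp (f := fun w => I * cexp (2*w)) w this (by fun_prop)
  have h2 : DifferentiableAt ℂ (fun w => cexp (w/2)) w := by fun_prop
  have h3 : DifferentiableAt ℂ (fun w => cexp (-w)) w := by fun_prop
  exact h2.fun_mul ((h1.sub_const 1).fun_sub h3)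

lemma kk_even {w : ℂ} (h : |w.im| < Real.pi/4) : kk (-w) = kk w := by
  have hS := jacobiTheta_S_smul ⟨I * cexp (2*w), kk_im_pos h⟩
  rw [UpperHalfPlane.modular_S_smul] at hS
  simp only [UpperHalfPlane.coe_mk] at hS
  have e1 : (-(I * cexp (2*w)))⁻¹ = I * cexp (2 * (-w)) := by
    rw [show 2 * (-w) = -(2*w) by ring, Complex.exp_neg, inv_neg, mul_inv, Complex.inv_I]
    ring
  have e2 : -I * (I * cexp (2*w)) = cexp (2*w) := by
    rw [← mul_assoc, neg_mul, I_mul_I]; ring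
  have e3 : cexp (2*w) ^ (1/2:ℂ) = cexp w := by
    have := abs_lt.1 h
    rw [Complex.cpow_def_of_ne_zero (Complex.exp_ne_zero _), Complex.log_exp (by simp; linarith)
      (by simp; linarith)]
    congr 1; ring
  rw [e2, e3, e1] at hS
  unfold kk
  rw [hS, neg_neg]
  have a1 : cexp (-w/2) * cexp w = cexp (w/2) := by rw [← Complex.exp_add]; congr 1; ring
  have a2 : cexp (w/2) * cexp (-w) = cexp (-w/2) := by rw [← Complex.exp_add]; congr 1; ring
  linear_combination (jacobiTheta (I * cexp (2*w)) - 1) * a1 + a2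

lemma kk_bound_pos {w : ℂ} {c : ℝ} (hc : 0 < c) (hcw : c ≤ Real.cos (2*w.im)) (hw : 0 ≤ w.re) :
    ‖kk w‖ ≤ (1/c+1) * Real.exp (-w.re/2) := by
  set y := (I * cexp (2*w)).im with hy
  have hyc : Real.exp (2*w.re) * c ≤ y := by
    rw [hy, kk_im]; gcongr
  have hy0 : 0 < y := lt_of_lt_of_le (by positivity) hyc
  have h1 := norm_jacobiTheta_sub_one_le (τ := I * cexp (2*w)) hy0
  rw [← hy] at h1
  have h2 : 2 / (1 - Real.exp (-Real.pi * y)) * Real.exp (-Real.pi * y) ≤ 1 / y := by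
    have e : Real.exp (-Real.pi * y) = (Real.exp (Real.pi * y))⁻¹ := by
      rw [← Real.exp_neg]; congr 1; ring
    rw [e]
    have h3 : Real.pi * y + 1 ≤ Real.exp (Real.pi*y) := Real.add_one_le_exp _
    have h4 := Real.pi_gt_three
    have h5 : 0 < Real.exp (Real.pi*y) - 1 := by nlinarith
    have : 2 / (1 - (Real.exp (Real.pi * y))⁻¹) * (Real.exp (Real.pi * y))⁻¹ =
        2 / (Real.exp (Real.pi*y) - 1) := by
      have h6 := Real.exp_pos (Real.pi * y)
      have : 1 - (Real.exp (Real.pi * y))⁻¹ = (Real.exp (Real.pi*y) - 1)/ Real.exp (Real.pi*y) := by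
        field_simp
      rw [this]; field_simp
    rw [this, div_le_div_iff₀ h5 hy0]
    nlinarith
  have h3 : 1 / y ≤ 1/c * Real.exp (-w.re) := by
    have : 1/c * Real.exp (-w.re) = 1 / (Real.exp w.re * c) := by
      rw [Real.exp_neg]; field_simp
    rw [this]
    apply one_div_le_one_div_of_le (by positivity)
    refine le_trans ?_ hyc
    gcongr
    linarith
  unfold kk
  rw [norm_mul, Complex.norm_exp]
  have e1 : (w/2).re = w.re/2 := by simp
  have h4 : ‖jacobiTheta (I * cexp (2*w)) - 1 - cexp (-w)‖ ≤ (1/c+1) * Real.exp (-w.re) := by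
    refine (norm_sub_le _ _).trans ?_
    rw [Complex.norm_exp, Complex.neg_re]
    linarith [h1.trans (h2.trans h3)]
  rw [e1]
  calc _ ≤ Real.exp (w.re/2) * ((1/c+1) * Real.exp (-w.re)) := by gcongr
    _ = (1/c+1) * (Real.exp (w.re/2) * Real.exp (-w.re)) := by ring
    _ = _ := by rw [← Real.exp_add]; congr 2; ring

lemma kk_bound {w : ℂ} {c : ℝ} (hc : 0 < c) (hcw : c ≤ Real.cos (2*w.im))
    (h : |w.im| < Real.pi/4) :
    ‖kk w‖ ≤ (1/c+1) * Real.exp (-|w.re|/2) := by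
  rcases le_total 0 w.re with h0 | h0
  · rw [abs_of_nonneg h0]; exact kk_bound_pos hc hcw h0
  · rw [← kk_even h, abs_of_nonpos h0]
    have := kk_bound_pos (w := -w) hc (by simpa using hcw) (by simpa using h0)
    simpa using this

/-- Size near the corner. -/
lemma kk_corner {v : ℝ} (h : |v| < Real.pi/4) :
    ‖kk (v * I)‖ ≤ 5 * (Real.cos (2*v)) ^ (-(1/2):ℝ) := by
  set y := Real.cos (2*v) with hy
  have hy0 : 0 < y := kk_cos_pos h
  have hy1 : y ≤ 1 := Real.cos_le_one _
  have him : (I * cexp (2*(v*I))).im = y := by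
    rw [kk_im]; simp [hy]
  set τ := I * cexp (2*(v*I)) with hτ
  have hτ0 : 0 < τ.im := by rw [him]; exact hy0
  have hIy : 0 < (I * (y:ℂ)).im := by simp [hy0]
  have hs := hasSum_jacobiTheta₂_term 0 hτ0
  have hs' := hasSum_jacobiTheta₂_term 0 hIy
  rw [← jacobiTheta_eq_jacobiTheta₂] at hs hs'
  have hn : ∀ n : ℤ, ‖jacobiTheta₂_term n 0 τ‖ = ‖jacobiTheta₂_term n 0 (I*y)‖ := by
    intro n
    rw [norm_jacobiTheta₂_term, norm_jacobiTheta₂_term, him]; simp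
  have hn' : ∀ n : ℤ, jacobiTheta₂_term n 0 (I*y) = ((‖jacobiTheta₂_term n 0 (I*y)‖ : ℝ) : ℂ) := by
    intro n
    rw [norm_jacobiTheta₂_term, jacobiTheta₂_term, Complex.ofReal_exp]
    congr 1
    simp
    linear_combination (Real.pi * n^2 * y : ℂ) * I_mul_I
  have hsr : HasSum (fun n : ℤ => ‖jacobiTheta₂_term n 0 τ‖) (jacobiTheta (I*y)).re := by
    have := Complex.hasSum_re hs'
    convert this using 1
    ext n
    rw [hn n, hn' n]; simp
  have h1 : ‖jacobiTheta τ‖ ≤ ‖jacobiTheta (I*y)‖ := by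
    calc _ ≤ (jacobiTheta (I*y)).re := by
            rw [← hs.tsum_eq, ← hsr.tsum_eq]; exact norm_tsum_le_tsum_norm hsr.summable
      _ ≤ _ := Complex.re_le_norm _
  have h2 : ‖jacobiTheta (I*y)‖ ≤ 3 * y^(-(1/2):ℝ) := by
    have hi : 0 < (I * ((y⁻¹:ℝ):ℂ)).im := by simp [hy0]
    have hS := jacobiTheta_S_smul ⟨I * ((y⁻¹:ℝ):ℂ), hi⟩
    rw [UpperHalfPlane.modular_S_smul] at hS
    simp only [UpperHalfPlane.coe_mk] at hS
    have e1 : (-(I * ((y⁻¹:ℝ):ℂ)))⁻¹ = I * y := by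
      rw [inv_neg, mul_inv, Complex.inv_I]; push_cast; rw [inv_inv]; ring
    have e2 : -I * (I * ((y⁻¹:ℝ):ℂ)) = ((y⁻¹:ℝ):ℂ) := by
      rw [← mul_assoc, neg_mul, I_mul_I]; ring
    rw [e1, e2] at hS
    rw [hS, norm_mul]
    have e3 : ‖((y⁻¹:ℝ):ℂ) ^ (1/2:ℂ)‖ = y^(-(1/2):ℝ) := by
      rw [Complex.norm_cpow_eq_rpow_re_of_pos (by positivity)]
      rw [Real.inv_rpow hy0.le, Real.rpow_neg hy0.le]; norm_num
    rw [e3, mul_comm]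
    gcongr
    have h3 := norm_jacobiTheta_sub_one_le hi
    have h4 : 1 ≤ (I * ((y⁻¹:ℝ):ℂ)).im := by
      simp; exact (one_le_inv₀ hy0).2 hy1
    set Y := (I * ((y⁻¹:ℝ):ℂ)).im
    have h5 : Real.exp (-Real.pi * Y) ≤ 1/2 := by
      have : Real.exp (-Real.pi * Y) ≤ Real.exp (-1) := by
        apply Real.exp_le_exp.2; nlinarith [Real.pi_gt_three]
      refine this.trans ?_
      rw [Real.exp_neg, one_div]
      apply inv_anti₀ (by norm_num)
      linarith [Real.add_one_le_exp (1:ℝ)]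
    have h6 : 2 / (1 - Real.exp (-Real.pi * Y)) * Real.exp (-Real.pi * Y) ≤ 2 := by
      rw [div_mul_eq_mul_div, div_le_iff₀ (by linarith)]; linarith
    have h7 : jacobiTheta (I * ((y⁻¹:ℝ):ℂ)) = (jacobiTheta (I * ((y⁻¹:ℝ):ℂ)) - 1) + 1 := by ring
    rw [h7]
    refine (norm_add_le _ _).trans ?_
    rw [norm_one]; linarith
  have h3 : 1 ≤ y^(-(1/2):ℝ) := Real.one_le_rpow_of_pos_of_le_one_of_nonpos hy0 hy1 (by norm_num)
  unfold kk
  rw [← hτ, norm_mul, Complex.norm_exp]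
  have : ((v:ℂ) * I / 2).re = 0 := by simp
  rw [this, Real.exp_zero, one_mul]
  refine (norm_sub_le _ _).trans ?_
  have h4 := norm_sub_le (jacobiTheta τ) 1
  rw [norm_one] at h4
  have h5 : ‖cexp (-(v*I))‖ = 1 := by rw [Complex.norm_exp]; simp
  rw [h5]; linarith


lemma integrable_exp_neg_abs_aux {b : ℝ} (hb : 0 < b) :
    MeasureTheory.Integrable (fun u : ℝ => Real.exp (-(b*|u|))) := by
  rw [← MeasureTheory.integrableOn_univ, ← Set.Iic_union_Ioi (a := (0:ℝ))]
  apply MeasureTheory.IntegrableOn.union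
  · refine (integrableOn_exp_mul_Iic hb 0).congr_fun ?_ measurableSet_Iic
    intro x hx
    simp only [mem_Iic] at hx
    simp only [abs_of_nonpos hx]; congr 1; ring
  · refine (integrableOn_exp_mul_Ioi (a := -b) (by linarith) 0).congr_fun ?_ measurableSet_Ioi
    intro x hx
    simp only [mem_Ioi] at hx
    simp only [abs_of_pos hx]; congr 1; ring

lemma kk_line_cont {v : ℝ} (h : |v| < Real.pi/4) : Continuous (fun u : ℝ => kk (u + v*I)) := by
  rw [continuous_iff_continuousAt]
  intro u
  have : ContinuousAt kk ((u:ℂ) + v*I) := (kk_diff (by simpa using h)).continuousAt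
  exact ContinuousAt.comp (f := fun u : ℝ => (u:ℂ) + v*I) this (by fun_prop)

lemma kk_line_int {v : ℝ} (h : |v| < Real.pi/4) :
    MeasureTheory.Integrable (fun u : ℝ => kk (u + v*I)) := by
  have hc := kk_cos_pos h
  refine ((integrable_exp_neg_abs_aux (b := 1/2) (by norm_num)).const_mul
    (1/Real.cos (2*v)+1)).mono' (kk_line_cont h).aestronglyMeasurable (Eventually.of_forall ?_)
  intro u
  have := kk_bound (w := (u:ℂ) + v*I) hc (by simp) (by simpa using h)
  refine this.trans (le_of_eq ?_)
  congr 2; simp; ring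

lemma kk_line_int' {v : ℝ} (h : |v| < Real.pi/4) (t : ℝ) :
    MeasureTheory.Integrable (fun u : ℝ => kk (u + v*I) * cexp (I * t * (u + v*I))) := by
  apply (kk_line_int h).mul_bdd (c := Real.exp (-(t*v))) (by fun_prop)
  refine Eventually.of_forall fun u => ?_
  rw [Complex.norm_exp]
  apply le_of_eq; congr 1; simp

lemma mellin_exp (f : ℝ → ℂ) (z : ℂ) :
    mellin f z = ∫ u : ℝ, cexp (z * u) * f (Real.exp u) := by
  have him : Real.exp '' univ = Ioi 0 := by rw [image_univ, Real.range_exp]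
  rw [mellin, ← him, MeasureTheory.integral_image_eq_integral_abs_deriv_smul
        MeasurableSet.univ (fun x _ => (Real.hasDerivAt_exp x).hasDerivWithinAt)
        Real.exp_injective.injOn]
  rw [MeasureTheory.setIntegral_univ]
  congr 1
  ext u
  rw [abs_of_pos (Real.exp_pos _), smul_eq_mul, Complex.real_smul, ← mul_assoc]
  congr 1
  rw [Complex.cpow_def_of_ne_zero (by exact_mod_cast (Real.exp_pos u).ne'),
    ← Complex.ofReal_log (Real.exp_pos u).le, Real.log_exp, Complex.ofReal_exp, ← Complex.exp_add]
  congr 1; ring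

lemma completed_fourier (t : ℝ) :
    completedRiemannZeta (1/2 + t*I) = ∫ u : ℝ, kk u * cexp (I * t * u) := by
  set z : ℂ := 1/4 + t/2*I with hz
  have hzre : z.re = 1/4 := by simp [hz]
  set P := HurwitzZeta.hurwitzEvenFEPair 0 with hP
  have h1 : completedRiemannZeta (1/2 + t*I) = P.Λ z / 2 := by
    rw [← HurwitzZeta.completedHurwitzZetaEven_zero, HurwitzZeta.completedHurwitzZetaEven]
    congr 2; rw [hz]; ring
  have h2 : P.Λ z = mellin P.f_modif z - 1/z - 1/(1/2 - z) := by
    rw [WeakFEPair.Λ, WeakFEPair.Λ₀]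
    simp [hP, HurwitzZeta.hurwitzEvenFEPair]
  have hθ : ∀ u : ℝ, P.f (Real.exp u) = jacobiTheta (I * cexp u) := by
    intro u
    have : P.f (Real.exp u) = ((HurwitzZeta.evenKernel 0 (Real.exp u) : ℝ) : ℂ) := rfl
    rw [this, HurwitzZeta.evenKernel_eq_cosKernel_of_zero]
    have h := HurwitzZeta.cosKernel_def 0 (Real.exp u)
    rw [jacobiTheta_eq_jacobiTheta₂]
    simpa using h
  have hg0 : P.g₀ = 1 := rfl
  have hf0 : P.f₀ = 1 := by simp [hP, HurwitzZeta.hurwitzEvenFEPair]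
  have he : P.ε = 1 := rfl
  have hk : P.k = 1/2 := rfl
  have h3 : (fun u : ℝ => cexp (z*u) * P.f_modif (Real.exp u)) =ᵐ[MeasureTheory.volume]
      fun u : ℝ => (kk ((2⁻¹ * u : ℝ)) * cexp (I * t * ((2⁻¹ * u:ℝ)))
        + (Iic (0:ℝ)).indicator (fun u : ℝ => cexp (z*u)) u)
        + (Ioi (0:ℝ)).indicator (fun u : ℝ => cexp ((z-1/2)*u)) u := by
    have : ∀ᵐ u : ℝ ∂MeasureTheory.volume, u ≠ 0 := by
      simp [MeasureTheory.ae_iff]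
    filter_upwards [this] with u hu
    have e0 : kk ((2⁻¹ * u : ℝ)) * cexp (I * t * ((2⁻¹ * u:ℝ))) =
        cexp (z*u) * jacobiTheta (I * cexp u) - cexp (z*u) - cexp ((z-1/2)*u) := by
      unfold kk
      have a1 : cexp (2 * ((2⁻¹ * u : ℝ):ℂ)) = cexp u := by congr 1; push_cast; ring
      have a2 : cexp (((2⁻¹ * u : ℝ):ℂ)/2) * cexp (I * t * ((2⁻¹ * u:ℝ))) = cexp (z*u) := by
        rw [← Complex.exp_add]; congr 1; rw [hz]; push_cast; ring
      have a3 : cexp (z*u) * cexp (-((2⁻¹ * u : ℝ):ℂ)) = cexp ((z-1/2)*u) := by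
        rw [← Complex.exp_add]; congr 1; push_cast; ring
      rw [a1, ← a3, ← a2]; ring
    rw [e0]
    rcases lt_or_gt_of_ne hu with h | h
    · have b1 : Real.exp u < 1 := by simpa using h
      simp only [WeakFEPair.f_modif, Pi.add_apply]
      rw [indicator_of_notMem (by simpa using b1.le), indicator_of_mem (show Real.exp u ∈ Ioo 0 1 from ⟨Real.exp_pos u, b1⟩),
        indicator_of_mem (show u ∈ Iic 0 from h.le), indicator_of_notMem (by simpa using h.le),
        hθ, hg0, he, hk, ← Real.exp_mul]
      have a3 : cexp (z*u) * cexp ((u * -(1/2):ℝ):ℂ) = cexp ((z-1/2)*u) := by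
        rw [← Complex.exp_add]; congr 1; push_cast; ring
      rw [← a3, Complex.ofReal_exp, smul_eq_mul]; ring
    · have b1 : 1 < Real.exp u := by simpa using h
      simp only [WeakFEPair.f_modif, Pi.add_apply]
      rw [indicator_of_mem (show Real.exp u ∈ Ioi 1 from b1), indicator_of_notMem (fun hh => absurd hh.2 (not_lt.2 b1.le)),
        indicator_of_notMem (by simpa using h), indicator_of_mem (show u ∈ Ioi 0 from h),
        hθ, hf0]
      ring
  have i1 : MeasureTheory.Integrable (fun u : ℝ => kk u * cexp (I * t * u)) := by
    have := kk_line_int' (v := 0) (by simp; positivity) t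
    simpa using this
  have i1' := i1.comp_mul_left' (R := (2⁻¹:ℝ)) (by norm_num)
  have i2 : MeasureTheory.Integrable ((Iic (0:ℝ)).indicator (fun u : ℝ => cexp (z*u))) :=
    (integrableOn_exp_mul_complex_Iic (by rw [hzre]; norm_num) 0).integrable_indicator
      measurableSet_Iic
  have hz2 : (z - 1/2).re = -1/4 := by rw [Complex.sub_re, hzre]; norm_num
  have i3 : MeasureTheory.Integrable ((Ioi (0:ℝ)).indicator (fun u : ℝ => cexp ((z-1/2)*u))) :=
    (integrableOn_exp_mul_complex_Ioi (by rw [hz2]; norm_num) 0).integrable_indicator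
      measurableSet_Ioi
  rw [h1, h2, mellin_exp, MeasureTheory.integral_congr_ae h3,
    MeasureTheory.integral_add (f := fun u : ℝ => kk ((2⁻¹ * u : ℝ)) * cexp (I * t * ((2⁻¹ * u:ℝ)))
        + (Iic (0:ℝ)).indicator (fun u : ℝ => cexp (z*u)) u) (i1'.add i2) i3, MeasureTheory.integral_add i1' i2,
    MeasureTheory.integral_indicator measurableSet_Iic,
    MeasureTheory.integral_indicator measurableSet_Ioi,
    integral_exp_mul_complex_Iic (by rw [hzre]; norm_num),
    integral_exp_mul_complex_Ioi (by rw [hz2]; norm_num),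
    MeasureTheory.Measure.integral_comp_mul_left (fun u : ℝ => kk u * cexp (I * t * u))]
  have n1 : z ≠ 0 := by intro h; rw [h] at hzre; norm_num at hzre
  have n2 : z - 1/2 ≠ 0 := by intro h; rw [h] at hz2; norm_num at hz2
  have n3 : 1/2 - z = -(z - 1/2) := by ring
  rw [n3]
  simp only [Complex.ofReal_zero, mul_zero, Complex.exp_zero]
  rw [div_neg]
  simp
  ring

/-- Contour shift. -/
lemma completed_shift (t : ℝ) {v : ℝ} (h : |v| < Real.pi/4) :
    ∫ u : ℝ, kk (u + v*I) * cexp (I * t * (u + v*I)) = completedRiemannZeta (1/2 + t*I) := by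
  rw [completed_fourier]
  set K : ℂ → ℂ := fun w => kk w * cexp (I * t * w) with hK
  have hi0 : MeasureTheory.Integrable (fun u : ℝ => K u) := by
    have := kk_line_int' (v := 0) (by simp; positivity) t
    simpa using this
  have hi1 : MeasureTheory.Integrable (fun u : ℝ => K (u + v*I)) := kk_line_int' h t
  have hy : ∀ y ∈ uIcc 0 v, |y| ≤ |v| := by
    intro y hy
    have := abs_sub_left_of_mem_uIcc hy
    simpa using this
  have hcv := kk_cos_pos h
  have hrect : ∀ R : ℝ, (∫ x : ℝ in (-R)..R, K x) - (∫ x : ℝ in (-R)..R, K (x + v * I)) +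
      I • (∫ y : ℝ in (0:ℝ)..v, K (R + y * I)) -
      I • (∫ y : ℝ in (0:ℝ)..v, K ((-R:ℝ) + y * I)) = 0 := by
    intro R
    have := Complex.integral_boundary_rect_eq_zero_of_differentiableOn K ((-R:ℝ):ℂ)
      ((R:ℂ) + v*I) ?_
    · simpa using this
    · intro w hw
      have hw2 : w.im ∈ uIcc 0 v := by
        have := hw.2
        simpa using this
      have hd : DifferentiableAt ℂ kk w := kk_diff (lt_of_le_of_lt (hy _ hw2) h)
      have hd2 : DifferentiableAt ℂ (fun w => cexp (I * t * w)) w := by fun_prop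
      exact (hd.fun_mul hd2).differentiableWithinAt
  have hKb : ∀ R y : ℝ, y ∈ uIcc 0 v →
      ‖K (R + y*I)‖ ≤ (1/Real.cos (2*v)+1) * Real.exp (|t| * |v|) * Real.exp (-(1/2)*|R|) := by
    intro R y hyv
    have hy1 := hy y hyv
    have hcos : Real.cos (2*v) ≤ Real.cos (2*y) := by
      rw [← Real.cos_abs (2*v), ← Real.cos_abs (2*y)]
      apply Real.cos_le_cos_of_nonneg_of_le_pi (abs_nonneg _)
      · rw [abs_mul, abs_two]; linarith [Real.pi_pos]
      · rw [abs_mul, abs_mul, abs_two]; linarith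
    have b1 := kk_bound (w := (R:ℂ) + y*I) hcv (by simpa using hcos) (by simpa using lt_of_le_of_lt hy1 h)
    have b2 : ‖cexp (I * t * (R + y*I))‖ ≤ Real.exp (|t| * |v|) := by
      rw [Complex.norm_exp]
      apply Real.exp_le_exp.2
      have : (I * t * (R + y*I)).re = -(t*y) := by simp
      rw [this]
      calc -(t*y) ≤ |t*y| := neg_le_abs _
        _ = |t| * |y| := abs_mul _ _
        _ ≤ _ := by gcongr
    rw [hK]; simp only
    rw [norm_mul]
    have e : ((R:ℂ) + y*I).re = R := by simp
    rw [e] at b1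
    calc _ ≤ ((1/Real.cos (2*v)+1) * Real.exp (-|R|/2)) * Real.exp (|t| * |v|) := by gcongr
      _ = _ := by rw [show -|R|/2 = -(1/2)*|R| by ring]; ring
  have hexp : Tendsto (fun R : ℝ => (1/Real.cos (2*v)+1) * Real.exp (|t| * |v|) * Real.exp (-(1/2)*|R|) * |v-0|)
      atTop (𝓝 0) := by
    have : Tendsto (fun R : ℝ => Real.exp (-(1/2)*|R|)) atTop (𝓝 0) := by
      apply Real.tendsto_exp_atBot.comp
      exact (tendsto_abs_atTop_atTop).const_mul_atTop_of_neg (by norm_num)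
    have := (this.const_mul ((1/Real.cos (2*v)+1) * Real.exp (|t| * |v|))).mul_const |v-0|
    simpa using this
  have v1 : Tendsto (fun R : ℝ => ∫ y : ℝ in (0:ℝ)..v, K (R + y * I)) atTop (𝓝 0) := by
    refine squeeze_zero_norm (fun R => ?_) hexp
    exact intervalIntegral.norm_integral_le_of_norm_le_const
      (fun y hy => hKb R y (uIoc_subset_uIcc hy))
  have v2 : Tendsto (fun R : ℝ => ∫ y : ℝ in (0:ℝ)..v, K ((-R:ℝ) + y * I)) atTop (𝓝 0) := by
    refine squeeze_zero_norm (fun R => ?_) hexp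
    refine intervalIntegral.norm_integral_le_of_norm_le_const
      (fun y hy => ?_)
    have := hKb (-R) y (uIoc_subset_uIcc hy)
    rwa [abs_neg] at this
  have l1 := MeasureTheory.intervalIntegral_tendsto_integral hi0 tendsto_neg_atTop_atBot tendsto_id
  have l2 := MeasureTheory.intervalIntegral_tendsto_integral hi1 tendsto_neg_atTop_atBot tendsto_id
  have hl := ((l1.sub l2).add (v1.const_smul I)).sub (v2.const_smul I)
  simp only [id] at hl
  have := tendsto_nhds_unique hl ((tendsto_const_nhds (x := (0:ℂ))).congr (fun R => (hrect R).symm))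
  simp only [smul_zero, add_zero, sub_zero] at this
  exact (sub_eq_zero.1 this).symm

open scoped FourierTransform

/-- Real values of the completed zeta function on the critical line. -/
noncomputable def LL (t : ℝ) : ℝ := (completedRiemannZeta (1/2 + t*I)).re

lemma LL_eq (t : ℝ) : completedRiemannZeta (1/2 + t*I) = (LL t : ℂ) := completed_real t

lemma LL_cont : Continuous LL := by
  have : Continuous (fun t : ℝ => completedRiemannZeta (1/2 + t*I)) := by
    rw [continuous_iff_continuousAt]
    intro t
    have : ContinuousAt completedRiemannZeta (1/2 + t*I) := by
      refine (differentiableAt_completedZeta ?_ ?_).continuousAt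
      · intro h; have := congrArg Complex.re h; norm_num at this
      · intro h; have := congrArg Complex.re h; norm_num at this
    exact ContinuousAt.comp (f := fun t : ℝ => (1/2:ℂ) + t*I) this (by fun_prop)
  exact Complex.continuous_re.comp this

lemma LL_even (t : ℝ) : LL (-t) = LL t := by
  unfold LL
  rw [← completedRiemannZeta_one_sub]
  congr 2; push_cast; ring

lemma shift_eq (t : ℝ) {v : ℝ} (h : |v| < Real.pi/4) :
    ∫ u : ℝ, kk (u + v*I) * cexp (I * t * u) = ((Real.exp (t*v) * LL t : ℝ) : ℂ) := by
  have h1 := completed_shift t h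
  have : (fun u : ℝ => kk (u + v*I) * cexp (I * t * (u + v*I))) =
      fun u : ℝ => (Real.exp (-(t*v)) : ℂ) * (kk (u + v*I) * cexp (I * t * u)) := by
    ext u
    have : cexp (I * t * (u + v*I)) = (Real.exp (-(t*v)) : ℂ) * cexp (I * t * u) := by
      rw [Complex.ofReal_exp, ← Complex.exp_add]; congr 1; push_cast
      linear_combination (t * v : ℂ) * I_mul_I
    rw [this]; ring
  rw [this, MeasureTheory.integral_const_mul, LL_eq] at h1
  push_cast at h1 ⊢
  rw [← h1, ← mul_assoc, ← Complex.exp_add]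
  simp

lemma LL_bound {v : ℝ} (h0 : 0 ≤ v) (h : v < Real.pi/4) :
    ∃ C, ∀ t, |LL t| ≤ C * Real.exp (-(v*|t|)) := by
  have hv : |v| < Real.pi/4 := by rwa [abs_of_nonneg h0]
  refine ⟨∫ u : ℝ, ‖kk (u + v*I)‖, fun t => ?_⟩
  have key : ∀ t : ℝ, Real.exp (t*v) * |LL t| ≤ ∫ u : ℝ, ‖kk (u + v*I)‖ := by
    intro t
    have h1 := congrArg norm (shift_eq t hv)
    rw [Complex.norm_real, Real.norm_eq_abs, abs_mul, abs_of_pos (Real.exp_pos _)] at h1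
    rw [← h1]
    refine (MeasureTheory.norm_integral_le_integral_norm _).trans (le_of_eq ?_)
    congr 1; ext u
    rw [norm_mul, Complex.norm_exp]; simp
  have : Real.exp (|t| * v) * |LL t| ≤ ∫ u : ℝ, ‖kk (u + v*I)‖ := by
    rcases le_total 0 t with ht | ht
    · rw [abs_of_nonneg ht]; exact key t
    · rw [abs_of_nonpos ht, ← LL_even]; exact key (-t)
  rw [Real.exp_neg, ← div_eq_mul_inv, le_div_iff₀ (Real.exp_pos _), mul_comm v]
  linarith

lemma LL_int {v : ℝ} (h0 : 0 ≤ v) (h : v < Real.pi/4) :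
    MeasureTheory.Integrable (fun t => Real.exp (t*v) * LL t) := by
  obtain ⟨v', h1, h2⟩ := exists_between h
  obtain ⟨C, hC⟩ := LL_bound (h0.trans h1.le) h2
  refine ((integrable_exp_neg_abs_aux (b := v'-v) (by linarith)).const_mul C).mono'
    (Continuous.aestronglyMeasurable (by have := LL_cont; fun_prop)) (Eventually.of_forall ?_)
  intro t
  rw [Real.norm_eq_abs, abs_mul, abs_of_pos (Real.exp_pos _)]
  calc _ ≤ Real.exp (|t| * v) * (C * Real.exp (-(v'*|t|))) := by
        gcongr
        · exact le_abs_self t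
        · exact hC t
    _ = C * (Real.exp (|t| * v) * Real.exp (-(v'*|t|))) := by ring
    _ = _ := by rw [← Real.exp_add]; congr 2; ring

lemma LL_inversion {v : ℝ} (h0 : 0 ≤ v) (h : v < Real.pi/4) :
    ((∫ t, Real.exp (t*v) * LL t : ℝ) : ℂ) = 2 * Real.pi * kk (v*I) := by
  have hv : |v| < Real.pi/4 := by rwa [abs_of_nonneg h0]
  set G : ℝ → ℂ := fun t => ((Real.exp (t*v) * LL t : ℝ) : ℂ) with hG
  set g : ℝ → ℂ := fun u => kk (u + v*I) with hg
  have hF : 𝓕 g = fun ξ : ℝ => G ((-(2*Real.pi)) * ξ) := by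
    ext ξ
    rw [Real.fourier_real_eq_integral_exp_smul, hG]
    simp only
    rw [← shift_eq _ hv]
    congr 1; ext u
    rw [smul_eq_mul, mul_comm, hg]
    congr 2; push_cast; ring
  have hGi : MeasureTheory.Integrable G := (LL_int h0 h).ofReal
  have hpi : (-(2*Real.pi)) ≠ 0 := by have := Real.pi_pos; linarith
  have hFi : MeasureTheory.Integrable (𝓕 g) := by
    rw [hF]; exact hGi.comp_mul_left' hpi
  have hinv := congrFun (Continuous.fourierInv_fourier_eq (kk_line_cont hv) (kk_line_int hv) hFi) 0
  rw [Real.fourierInv_eq'] at hinv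
  simp only [inner_zero_right, mul_zero, Complex.ofReal_zero, zero_mul, Complex.exp_zero,
    one_smul, zero_add] at hinv
  rw [← hinv]
  change _ = 2 * (Real.pi:ℂ) * ∫ ξ, (𝓕 g) ξ
  rw [hF, MeasureTheory.Measure.integral_comp_mul_left G, ← integral_complex_ofReal]
  have hp := Real.pi_pos
  rw [abs_inv, abs_neg, abs_of_pos (by positivity), Complex.real_smul]
  push_cast
  have : (Real.pi:ℂ) ≠ 0 := by exact_mod_cast hp.ne'
  rw [hG]
  push_cast
  field_simp
  congr 1; ext y; rw [mul_comm (v:ℂ)]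

lemma LL_lower : ∃ c : ℝ, 0 < c ∧ ∀ t : ℝ, 2 ≤ t → 1 < ‖riemannZeta (1/2 + t*I)‖ →
    c * ((t/2)^(-(1/4):ℝ) * Real.exp (-(Real.pi*t/4))) ≤ |LL t| := by
  obtain ⟨c, hc, h⟩ := gamma_lower
  refine ⟨Real.pi^(-(1/4):ℝ) * c, by positivity, fun t ht hz => ?_⟩
  have h1 : |LL t| = ‖Gammaℝ (1/2 + t*I)‖ * ‖riemannZeta (1/2+t*I)‖ := by
    rw [← norm_mul, ← zeta_eq, LL_eq, Complex.norm_real, Real.norm_eq_abs]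
    · intro h; have := congrArg Complex.re h; norm_num at this
    · norm_num
  have h2 := norm_gammaR (1/2) t
  have h3 := h (t/2) (by linarith)
  have e1 : (((1/2:ℝ):ℂ) + t*I) = 1/2 + t*I := by push_cast; ring
  have e2 : (((1/2)/2:ℝ):ℂ) + ((t/2:ℝ):ℂ)*I = 1/4 + ((t/2:ℝ):ℂ)*I := by push_cast; ring
  rw [e1, e2] at h2
  have e3 : Real.pi * (t/2) / 2 = Real.pi * t/4 := by ring
  have e4 : (-((1/2)/2):ℝ) = -(1/4) := by norm_num
  rw [e3] at h3
  rw [e4] at h2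
  rw [h1, h2]
  have hp := Real.pi_pos
  calc _ = Real.pi^(-(1/4):ℝ) * (c * ((t/2)^(-(1/4):ℝ) * Real.exp (-(Real.pi*t/4)))) * 1 := by ring
    _ ≤ _ := by gcongr

lemma not_large (T : ℝ) (hT : ∀ t : ℝ, T ≤ t → 1 < ‖riemannZeta (1/2 + t*I)‖) : False := by
  wlog hT2 : 2 ≤ T generalizing T
  · exact this (max T 2) (fun t ht => hT t ((le_max_left _ _).trans ht)) (le_max_right _ _)
  obtain ⟨c, hc, hlow⟩ := LL_lower
  have hlow' : ∀ t, T ≤ t → c * ((t/2)^(-(1/4):ℝ) * Real.exp (-(Real.pi*t/4))) ≤ |LL t| :=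
    fun t ht => hlow t (hT2.trans ht) (hT t ht)
  have hne : ∀ t, T ≤ t → LL t ≠ 0 := by
    intro t ht h
    have := hlow' t ht
    rw [h, abs_zero] at this
    have h1 : 0 < t/2 := by linarith
    have : 0 < c * ((t/2)^(-(1/4):ℝ) * Real.exp (-(Real.pi*t/4))) := by positivity
    linarith
  obtain ⟨s, hs1, hs⟩ : ∃ s : ℝ, |s| = 1 ∧ ∀ t, T ≤ t → s * LL t = |LL t| := by
    have hpre : IsPreconnected (Ici T) := isPreconnected_Ici
    by_cases h : 0 < LL T
    · refine ⟨1, by simp, fun t ht => ?_⟩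
      rw [one_mul]
      by_contra h2
      have h3 : LL t < 0 := by
        by_contra h4
        exact h2 (abs_of_nonneg (not_lt.1 h4)).symm
      obtain ⟨x, hx, hx0⟩ := hpre.intermediate_value (a := t) (b := T) ht (mem_Ici.2 le_rfl)
        LL_cont.continuousOn ⟨h3.le, h.le⟩
      exact hne x hx hx0
    · refine ⟨-1, by simp, fun t ht => ?_⟩
      by_contra h2
      have h3 : 0 < LL t := by
        by_contra h4
        exact h2 (by rw [abs_of_nonpos (not_lt.1 h4)]; ring)
      obtain ⟨x, hx, hx0⟩ := hpre.intermediate_value (a := T) (b := t) (mem_Ici.2 le_rfl) ht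
        LL_cont.continuousOn ⟨not_lt.1 h, h3.le⟩
      exact hne x hx hx0
  have hs' : ∀ t, T ≤ |t| → 0 ≤ s * LL t := by
    intro t ht
    rcases le_total 0 t with h | h
    · rw [abs_of_nonneg h] at ht; rw [hs t ht]; exact abs_nonneg _
    · rw [abs_of_nonpos h] at ht; rw [← LL_even, hs _ ht]; exact abs_nonneg _
  obtain ⟨M, hM⟩ := LL_bound (v := 0) le_rfl (by positivity)
  simp only [zero_mul, neg_zero, Real.exp_zero, mul_one] at hM
  have hM0 : 0 ≤ M := (abs_nonneg _).trans (hM 0)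
  set b := Real.exp T * M with hb
  have hb0 : 0 ≤ b := by positivity
  have main : ∀ A : ℝ, T < A → c * A^(-(1/4):ℝ) * Real.exp (-2) * A - b * (2*T) ≤
      10 * Real.pi * A^(1/2:ℝ) := by
    intro A hA
    have hA0 : 0 < A := by linarith
    have hpi3 := Real.pi_gt_three
    have hη : 1/A < 1/2 := by
      apply one_div_lt_one_div_of_lt <;> linarith
    set η := 1/A with hηd
    have hη0 : 0 < η := by positivity
    set v := Real.pi/4 - η with hv
    have hv0 : 0 ≤ v := by linarith
    have hv4 : v < Real.pi/4 := by linarith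
    have hv1 : v ≤ 1 := by linarith [Real.pi_le_four]
    set m := c * A^(-(1/4):ℝ) * Real.exp (-2) with hm
    have hpt : ∀ t, (Icc A (2*A)).indicator (fun _ => m) t - (Icc (-T) T).indicator (fun _ => b) t
        ≤ s * (Real.exp (t*v) * LL t) := by
      intro t
      by_cases h1 : t ∈ Icc (-T) T
      · have h2 : t ∉ Icc A (2*A) := fun h => by linarith [h.1, h1.2]
        rw [indicator_of_mem h1, indicator_of_notMem h2, zero_sub]
        apply neg_le_of_abs_le
        rw [abs_mul, hs1, one_mul, abs_mul, abs_of_pos (Real.exp_pos _), hb]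
        have hvT : t * v ≤ T := by nlinarith [h1.1, h1.2]
        exact mul_le_mul (Real.exp_le_exp.2 hvT) (hM t) (abs_nonneg _) (Real.exp_pos _).le
      · rw [indicator_of_notMem h1, sub_zero]
        by_cases h2 : t ∈ Icc A (2*A)
        · rw [indicator_of_mem h2]
          have hTt : T ≤ t := by linarith [h2.1]
          have ht0 : 0 < t := by linarith
          have e : s * (Real.exp (t*v) * LL t) = Real.exp (t*v) * |LL t| := by
            rw [← hs t hTt]; ring
          rw [e, hm]
          have e1 : A^(-(1/4):ℝ) ≤ (t/2)^(-(1/4):ℝ) := by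
            apply Real.rpow_le_rpow_of_nonpos (by linarith) (by linarith [h2.2]) (by norm_num)
          have e2 : Real.exp (-2) ≤ Real.exp (t*v) * Real.exp (-(Real.pi*t/4)) := by
            rw [← Real.exp_add]
            apply Real.exp_le_exp.2
            have : t * v + -(Real.pi*t/4) = - (t * η) := by rw [hv]; ring
            rw [this]
            have : t * η ≤ 2*A*η := by have := h2.2; gcongr
            have : 2*A*η = 2 := by rw [hηd]; field_simp
            linarith
          calc c * A^(-(1/4):ℝ) * Real.exp (-2) ≤ c * (t/2)^(-(1/4):ℝ) *
                (Real.exp (t*v) * Real.exp (-(Real.pi*t/4))) := by gcongr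
            _ = Real.exp (t*v) * (c * ((t/2)^(-(1/4):ℝ) * Real.exp (-(Real.pi*t/4)))) := by ring
            _ ≤ _ := by gcongr; exact hlow' t hTt
        · rw [indicator_of_notMem h2]
          have : T ≤ |t| := by
            by_contra h3
            have := abs_lt.1 (not_le.1 h3)
            exact h1 ⟨this.1.le, this.2.le⟩
          have := hs' t this
          have e : s * (Real.exp (t*v) * LL t) = Real.exp (t*v) * (s * LL t) := by ring
          rw [e]; positivity
    have i1 : MeasureTheory.Integrable ((Icc A (2*A)).indicator (fun _ : ℝ => m)) :=
      (MeasureTheory.integrableOn_const (by simp)).integrable_indicator measurableSet_Icc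
    have i2 : MeasureTheory.Integrable ((Icc (-T) T).indicator (fun _ : ℝ => b)) :=
      (MeasureTheory.integrableOn_const (by simp)).integrable_indicator measurableSet_Icc
    have hintg := MeasureTheory.integral_mono (i1.sub i2) ((LL_int hv0 hv4).const_mul s) hpt
    simp only [Pi.sub_apply] at hintg
    rw [MeasureTheory.integral_sub i1 i2, MeasureTheory.integral_indicator_const _ measurableSet_Icc,
      MeasureTheory.integral_indicator_const _ measurableSet_Icc, MeasureTheory.integral_const_mul,
      Real.volume_real_Icc_of_le (by linarith), Real.volume_real_Icc_of_le (by linarith)] at hintg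
    have hup : s * ∫ t, Real.exp (t*v) * LL t ≤ 10 * Real.pi * A^(1/2:ℝ) := by
      have h1 := congrArg norm (LL_inversion hv0 hv4)
      rw [Complex.norm_real, Real.norm_eq_abs] at h1
      refine (le_abs_self _).trans ?_
      rw [abs_mul, hs1, one_mul, h1, norm_mul]
      have e0 : ‖(2:ℂ) * Real.pi‖ = 2 * Real.pi := by
        rw [norm_mul, Complex.norm_real, Real.norm_eq_abs, abs_of_pos Real.pi_pos]; simp
      have hcor := kk_corner (v := v) (by rwa [abs_of_nonneg hv0])
      have hcos : η ≤ Real.cos (2*v) := by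
        have : Real.cos (2*v) = Real.sin (2*η) := by
          rw [← Real.cos_pi_div_two_sub]; congr 1; rw [hv]; ring
        rw [this]
        have h5 := Real.mul_le_sin (x := 2*η) (by linarith) (by linarith)
        refine le_trans ?_ h5
        have : 2 / Real.pi * (2*η) = 4*η/Real.pi := by ring
        rw [this, le_div_iff₀ Real.pi_pos]
        nlinarith [Real.pi_le_four]
      have hcos2 : (Real.cos (2*v))^(-(1/2):ℝ) ≤ A^(1/2:ℝ) := by
        have : A^(1/2:ℝ) = η^(-(1/2):ℝ) := by
          rw [hηd, one_div A, Real.inv_rpow hA0.le, Real.rpow_neg hA0.le, inv_inv]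
        rw [this]
        exact Real.rpow_le_rpow_of_nonpos hη0 hcos (by norm_num)
      rw [e0]
      calc _ ≤ 2 * Real.pi * (5 * A^(1/2:ℝ)) := by gcongr; linarith
        _ = _ := by ring
    have := hintg.trans hup
    simp only [smul_eq_mul] at this
    linarith
  set D := (b*(2*T) + 10*Real.pi) / (c * Real.exp (-2)) with hD
  have hD0 : 0 ≤ D := by positivity
  obtain ⟨A, hA⟩ : ∃ A, A = max (T+1) ((D+1)^4) := ⟨_, rfl⟩
  have hAT : T < A := by rw [hA]; exact lt_of_lt_of_le (by linarith) (le_max_left _ _)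
  have hA1 : 1 ≤ A := by linarith
  have hA0 : 0 < A := by linarith
  have h1 := main A hAT
  have e1 : A^(-(1/4):ℝ) * A = A^(1/4:ℝ) * A^(1/2:ℝ) := by
    rw [← Real.rpow_add hA0]
    nth_rewrite 2 [← Real.rpow_one A]
    rw [← Real.rpow_add hA0]; norm_num
  have h2 : 1 ≤ A^(1/2:ℝ) := Real.one_le_rpow hA1 (by norm_num)
  have h3 : D + 1 ≤ A^(1/4:ℝ) := by
    have : ((D+1)^4)^(1/4:ℝ) = D+1 := by
      rw [← Real.rpow_natCast, ← Real.rpow_mul (by linarith)]; norm_num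
    rw [← this]
    apply Real.rpow_le_rpow (by positivity) _ (by norm_num)
    rw [hA]; exact le_max_right _ _
  have hce : 0 < c * Real.exp (-2) := by positivity
  have h4 : c * Real.exp (-2) * (A^(1/4:ℝ) * A^(1/2:ℝ)) ≤
      (b*(2*T) + 10*Real.pi) * A^(1/2:ℝ) := by
    rw [← e1]
    have : 0 ≤ b*(2*T) := by positivity
    nlinarith
  have h5 : b*(2*T) + 10*Real.pi = D * (c * Real.exp (-2)) := by
    rw [hD]; field_simp
  rw [h5] at h4
  have h6 : (D+1) * A^(1/2:ℝ) ≤ A^(1/4:ℝ) * A^(1/2:ℝ) := by gcongr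
  have h7 : A^(1/4:ℝ) * A^(1/2:ℝ) ≤ D * A^(1/2:ℝ) := by
    have : c * Real.exp (-2) * (A^(1/4:ℝ) * A^(1/2:ℝ)) ≤ c * Real.exp (-2) * (D * A^(1/2:ℝ)) := by
      linarith
    exact le_of_mul_le_mul_left this hce
  linarith


lemma core_approx (a : ℂ) (δ : ℝ) (hδ : 0 < δ) : ∃ M : ℝ, 0 < M ∧ ∀ T₀ : ℝ, ∃ t x : ℝ, T₀ ≤ t ∧
    |x| ≤ M / Real.log t ∧ ‖riemannZeta (1/2 + x + t*I) - a‖ < δ := by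
  obtain ⟨M, hM, h⟩ := small_or_large a δ hδ
  refine ⟨M, hM, fun T₀ => ?_⟩
  by_contra hcon
  obtain ⟨T, hT⟩ := h T₀ (by
    intro t x ht hx
    by_contra h1
    exact hcon ⟨t, x, ht, hx, not_le.1 h1⟩)
  exact not_large T hT

/-- The starting points of the recursive search. -/
noncomputable def pseq (tf : ℕ → ℝ → ℝ) : ℕ → ℝ
  | 0 => 0
  | n+1 => tf n (pseq tf n) + 1

lemma bumps (τ x : ℕ → ℝ) (hτ : ∀ n, τ n + 1 ≤ τ (n+1)) (hn : ∀ n : ℕ, (n:ℝ) ≤ τ n) :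
    ∃ ε : ℝ → ℝ, Continuous ε ∧ (∀ n, ε (τ n) = x n) ∧
      ∀ t, ε t = 0 ∨ ∃ n, |t - τ n| < 1/4 ∧ |ε t| ≤ |x n| := by
  have hmono : StrictMono τ := strictMono_nat_of_lt_succ (fun n => by linarith [hτ n])
  have hsep : ∀ m n, m < n → τ m + 1 ≤ τ n := fun m n h =>
    (hτ m).trans (hmono.monotone h)
  set b : ℕ → ℝ → ℝ := fun n t => x n * max 0 (1 - 4 * |t - τ n|) with hb
  have hb0 : ∀ n t, 1/4 ≤ |t - τ n| → b n t = 0 := by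
    intro n t h
    rw [hb]; simp only
    rw [max_eq_left (by linarith), mul_zero]
  have huniq : ∀ n t, |t - τ n| < 1/4 → ∑ᶠ m, b m t = b n t := by
    intro n t h
    apply finsum_eq_single
    intro m hm
    apply hb0
    by_contra h1
    have h1 := abs_lt.1 (not_le.1 h1)
    have h := abs_lt.1 h
    rcases lt_or_gt_of_ne hm with h2 | h2
    · linarith [hsep _ _ h2]
    · linarith [hsep _ _ h2]
  refine ⟨fun t => ∑ᶠ n, b n t, ?_, ?_, ?_⟩
  · apply continuous_finsum
    · intro n; rw [hb]; fun_prop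
    · intro t
      refine ⟨Metric.ball t 1, Metric.ball_mem_nhds _ one_pos, ?_⟩
      refine (Set.finite_Iic (⌈t+2⌉₊)).subset ?_
      rintro n ⟨y, hy1, hy2⟩
      rw [Metric.mem_ball, Real.dist_eq] at hy2
      have h1 : |y - τ n| < 1/4 := by
        by_contra h
        exact hy1 (hb0 n y (not_lt.1 h))
      have h1 := abs_lt.1 h1
      have h2 := abs_lt.1 hy2
      have h3 := hn n
      rw [mem_Iic]
      have : (n:ℝ) ≤ ⌈t+2⌉₊ := by linarith [Nat.le_ceil (t+2)]
      exact_mod_cast this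
  · intro n
    simp only
    rw [huniq n (τ n) (by simp)]
    simp [hb]
  · intro t
    by_cases h : ∃ n, |t - τ n| < 1/4
    · obtain ⟨n, h⟩ := h
      right
      refine ⟨n, h, ?_⟩
      simp only
      rw [huniq n t h, hb]
      simp only
      rw [abs_mul]
      have h1 : max 0 (1 - 4 * |t - τ n|) ≤ 1 := max_le zero_le_one (by linarith [abs_nonneg (t - τ n)])
      have h2 : 0 ≤ max 0 (1 - 4 * |t - τ n|) := le_max_left _ _
      rw [abs_of_nonneg h2]
      exact mul_le_of_le_one_right (abs_nonneg _) h1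
    · left
      have : ∀ n, b n t = 0 := fun n => hb0 n t (by
        by_contra h1
        exact h ⟨n, not_le.1 h1⟩)
      simp [this]

theorem stmt9
    (μ : ℝ → ℝ) (hμpos : ∀ t : ℝ, 2 ≤ t → 0 < μ t)
    (hμ : Tendsto μ atTop atTop) :
    ∃ ε : ℝ → ℝ, ContinuousOn ε (Set.Ici 2) ∧ Tendsto ε atTop (𝓝 0) ∧
      (∀ t : ℝ, 2 ≤ t → |ε t| ≤ μ t / Real.log t) ∧
      Dense {z : ℂ | ∃ t : ℝ, 2 ≤ t ∧
        z = riemannZeta ((1 / 2 : ℂ) + (ε t : ℝ) + t * Complex.I)} := by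
  have hcore : ∀ n : ℕ, ∃ M : ℝ, 0 < M ∧ ∀ T₀ : ℝ, ∃ t x : ℝ, T₀ ≤ t ∧
      |x| ≤ M / Real.log t ∧ ‖riemannZeta (1/2 + x + t*I) -
        TopologicalSpace.denseSeq ℂ n.unpair.1‖ < 1 / ((n.unpair.2 : ℝ) + 1) :=
    fun n => core_approx _ _ (by positivity)
  choose M hM0 hM using hcore
  have hstep : ∀ (n : ℕ) (T : ℝ), ∃ t x : ℝ, T ≤ t ∧ 4 ≤ t ∧
      |x| ≤ M n / Real.log t ∧ ‖riemannZeta (1/2 + x + t*I) -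
        TopologicalSpace.denseSeq ℂ n.unpair.1‖ < 1 / ((n.unpair.2 : ℝ) + 1) ∧
      (∀ t', t - 1 ≤ t' → 2 * M n ≤ μ t') ∧ M n / Real.log t ≤ 1 / ((n:ℝ)+1) := by
    intro n T
    obtain ⟨T1, hT1⟩ := eventually_atTop.1 (hμ.eventually_ge_atTop (2 * M n))
    obtain ⟨T2, hT2⟩ := eventually_atTop.1
      (Real.tendsto_log_atTop.eventually_ge_atTop (M n * ((n:ℝ)+1)))
    obtain ⟨t, x, ht, hx, hz⟩ := hM n (max (max T 4) (max (T1+1) T2))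
    have h1 : T ≤ t := ((le_max_left _ _).trans (le_max_left _ _)).trans ht
    have h2 : 4 ≤ t := ((le_max_right _ _).trans (le_max_left _ _)).trans ht
    have h3 : T1 + 1 ≤ t := ((le_max_left _ _).trans (le_max_right _ _)).trans ht
    have h4 : T2 ≤ t := ((le_max_right _ _).trans (le_max_right _ _)).trans ht
    refine ⟨t, x, h1, h2, hx, hz, fun t' ht' => hT1 t' (by linarith), ?_⟩
    have h5 := hT2 t h4
    have h6 : 0 < Real.log t := Real.log_pos (by linarith)
    rw [div_le_div_iff₀ h6 (by positivity)]
    linarith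
  choose tf xf h1 h2 h3 h4 h5 h6 using hstep
  set τ : ℕ → ℝ := fun n => tf n (pseq tf n) with hτ
  set x : ℕ → ℝ := fun n => xf n (pseq tf n) with hx
  have hsucc : ∀ n, τ n + 1 ≤ τ (n+1) := fun n => h1 (n+1) (pseq tf (n+1))
  have hτ4 : ∀ n, 4 ≤ τ n := fun n => h2 n _
  have hn : ∀ n : ℕ, (n:ℝ) ≤ τ n := by
    intro n
    induction n with
    | zero => have := hτ4 0; push_cast; linarith
    | succ k ih => have := hsucc k; push_cast; linarith
  have hmono : StrictMono τ := strictMono_nat_of_lt_succ (fun n => by linarith [hsucc n])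
  obtain ⟨ε, hc, hv, hd⟩ := bumps τ x hsucc hn
  refine ⟨ε, hc.continuousOn, ?_, ?_, ?_⟩
  · rw [Metric.tendsto_atTop]
    intro e he
    obtain ⟨N, hN⟩ := exists_nat_one_div_lt he
    refine ⟨τ N + 1, fun t ht => ?_⟩
    rw [Real.dist_eq, sub_zero]
    rcases hd t with h | ⟨n, hn1, hn2⟩
    · rw [h, abs_zero]; exact he
    · have hn1 := abs_lt.1 hn1
      have hNn : N ≤ n := by
        by_contra h
        have := hmono (not_le.1 h)
        linarith
      have hNn' : (N:ℝ) ≤ n := by exact_mod_cast hNn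
      calc |ε t| ≤ |x n| := hn2
        _ ≤ M n / Real.log (τ n) := h3 n _
        _ ≤ 1 / ((n:ℝ)+1) := h6 n _
        _ ≤ 1 / ((N:ℝ)+1) := by
          apply one_div_le_one_div_of_le (by positivity); linarith
        _ < e := hN
  · intro t ht
    have hlog : 0 < Real.log t := Real.log_pos (by linarith)
    rcases hd t with h | ⟨n, hn1, hn2⟩
    · rw [h, abs_zero]
      exact (div_pos (hμpos t ht) hlog).le
    · have hn1 := abs_lt.1 hn1
      have hτn := hτ4 n
      have hlτ : 0 < Real.log (τ n) := Real.log_pos (by linarith)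
      have hll : Real.log t ≤ 2 * Real.log (τ n) := by
        have : 2 * Real.log (τ n) = Real.log ((τ n)^2) := by rw [Real.log_pow]; norm_num
        rw [this]
        apply Real.log_le_log (by linarith)
        nlinarith
      have hμt : 2 * M n ≤ μ t := h5 n (pseq tf n) t (by
        change τ n - 1 ≤ t
        linarith)
      calc |ε t| ≤ |x n| := hn2
        _ ≤ M n / Real.log (τ n) := h3 n _
        _ ≤ μ t / Real.log t := by
          rw [div_le_div_iff₀ hlτ hlog]
          have := hM0 n
          nlinarith
  · rw [Metric.dense_iff]
    intro z r hr
    obtain ⟨i, hi⟩ := (TopologicalSpace.denseRange_denseSeq ℂ).exists_dist_lt z (half_pos hr)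
    obtain ⟨j, hj⟩ := exists_nat_one_div_lt (half_pos hr)
    set n := Nat.pair i j with hnd
    refine ⟨riemannZeta ((1 / 2 : ℂ) + (ε (τ n) : ℝ) + (τ n) * Complex.I), ?_, τ n,
      by linarith [hτ4 n], rfl⟩
    have hz := h4 n (pseq tf n)
    rw [hnd, Nat.unpair_pair] at hz
    simp only at hz
    rw [← hnd] at hz
    rw [Metric.mem_ball, hv n, dist_eq_norm]
    have e : riemannZeta (1/2 + (x n:ℂ) + (τ n:ℂ) * I) - z =
      (riemannZeta (1/2 + (x n:ℂ) + (τ n:ℂ) * I) - TopologicalSpace.denseSeq ℂ i) -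
        (z - TopologicalSpace.denseSeq ℂ i) := by ring
    rw [e]
    refine lt_of_le_of_lt (norm_sub_le _ _) ?_
    rw [dist_eq_norm] at hi
    have hz' : ‖riemannZeta (1/2 + (x n:ℂ) + (τ n:ℂ) * I) - TopologicalSpace.denseSeq ℂ i‖
      < 1 / ((j:ℝ)+1) := hz
    linarith
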